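/- Consider the random graph G(n, p) with p = p(n) = λ_n/n, where λ_n → λ for some λ > 0, and for k ≥ 0 let N_k = N_k(n) be the number of vertices of degree k. Let (a_k)_{k=0}^∞ be a sequence of real numbers with a_k = O(A^k) for some A < ∞. Then n^{-1/2}(Σ_k a_k N_k − n Σ_k a_k π_{λ_n}(k)) converges in distribution to a normal random variable with mean 0 and variance Σ_{j,k} a_j a_k σ_{jk}, where σ_{jk} := π_λ(j) π_λ(k) ((j−λ)(k−λ)/λ − 1) + π_λ(k) δ_{jk} (the double series being absolutely convergent). -/

import Mathlib

open MeasureTheory ProbabilityTheory Filter Topology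

noncomputable section

/-- Convergence in distribution (weak convergence of laws): integrals of every bounded
continuous function converge. -/
def TendstoInDistribution {E : Type*} [MeasurableSpace E] [TopologicalSpace E]
    (μs : ℕ → Measure E) (μ : Measure E) : Prop :=
  ∀ f : BoundedContinuousFunction E ℝ,
    Tendsto (fun n => ∫ x, f x ∂(μs n)) atTop (𝓝 (∫ x, f x ∂μ))

/-- `κ` is a version of the conditional distribution of the first coordinate given the
second coordinate, for the joint law `μ`: it is a Markov kernel which disintegrates `μ`. -/
def IsCondLaw {E F : Type*} [MeasurableSpace E] [MeasurableSpace F]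
    (μ : Measure (E × F)) (κ : Kernel F E) : Prop :=
  IsMarkovKernel κ ∧
  ∀ s : Set E, ∀ t : Set F, MeasurableSet s → MeasurableSet t →
    μ (s ×ˢ t) = ∫⁻ z in t, κ z s ∂(μ.map Prod.snd)

/-- A family of measures `κ z` (conditional distributions) is stochastically increasing:
`P(X ≤ x | Y = z)` is weakly decreasing in `z`. -/
def StochIncrFam {E F : Type*} [MeasurableSpace E] [Preorder E] [Preorder F]
    (κ : F → Measure E) : Prop :=
  ∀ z₁ z₂ : F, z₁ ≤ z₂ → ∀ x : E, κ z₂ {w | w ≤ x} ≤ κ z₁ {w | w ≤ x}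

/-- A family of measures `κ z` is stochastically decreasing: `P(X ≥ x | Y = z)` is weakly
decreasing in `z` (equivalently, `-X` is stochastically increasing). -/
def StochDecrFam {E F : Type*} [MeasurableSpace E] [Preorder E] [Preorder F]
    (κ : F → Measure E) : Prop :=
  ∀ z₁ z₂ : F, z₁ ≤ z₂ → ∀ x : E, κ z₂ {w | x ≤ w} ≤ κ z₁ {w | x ≤ w}

/-- Covariance of two real functionals under a measure. -/
def covFn {E : Type*} [MeasurableSpace E] (μ : Measure E) (f g : E → ℝ) : ℝ :=
  ∫ x, f x * g x ∂μ - (∫ x, f x ∂μ) * (∫ x, g x ∂μ)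

/-- A measure on a real normed space is Gaussian (jointly normal, possibly degenerate) if
every continuous linear functional pushes it forward to a one-dimensional Gaussian law. -/
def IsGaussianMeasure {E : Type*} [NormedAddCommGroup E] [NormedSpace ℝ E]
    [MeasurableSpace E] (μ : Measure E) : Prop :=
  ∀ L : E →L[ℝ] ℝ, ∃ m : ℝ, ∃ v : NNReal, μ.map (fun x => L x) = gaussianReal m v

open scoped ENNReal

/-- The index type for potential edges of a graph on `Fin n`: unordered pairs of distinct
vertices. -/
abbrev EdgeIdx (n : ℕ) := {e : Sym2 (Fin n) // ¬ e.IsDiag}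

/-- The Erdős–Rényi measure `G(n,p)`: each potential edge is present independently with
probability `p`; a graph is encoded as its edge indicator `S : EdgeIdx n → Bool`. -/
def gnpMeasure (n : ℕ) (p : ℝ) : Measure (EdgeIdx n → Bool) :=
  ∑ S : EdgeIdx n → Bool,
    (∏ e : EdgeIdx n, if S e then ENNReal.ofReal p else ENNReal.ofReal (1 - p)) •
      Measure.dirac S

/-- The number of edges of the graph `S`. -/
def edgeCount (n : ℕ) (S : EdgeIdx n → Bool) : ℕ :=
  (Finset.univ.filter fun e : EdgeIdx n => S e = true).card

/-- The uniform measure `G(n,m)` on graphs on `Fin n` with exactly `m` edges. -/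
def gnmMeasure (n m : ℕ) : Measure (EdgeIdx n → Bool) :=
  ∑ S : EdgeIdx n → Bool,
    (if edgeCount n S = m then
        ((Finset.univ.filter fun S' : EdgeIdx n → Bool => edgeCount n S' = m).card :
          ℝ≥0∞)⁻¹
      else 0) • Measure.dirac S

/-- The degree of the vertex `v` in the graph `S`. -/
def degree (n : ℕ) (S : EdgeIdx n → Bool) (v : Fin n) : ℕ :=
  (Finset.univ.filter fun e : EdgeIdx n => S e = true ∧ v ∈ (e : Sym2 (Fin n))).card

/-- The number of vertices of degree `k` in the graph `S`. -/
def degCount (n : ℕ) (k : ℕ) (S : EdgeIdx n → Bool) : ℕ :=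
  (Finset.univ.filter fun v : Fin n => degree n S v = k).card

/-- The Poisson point probabilities `π_λ(k) = e^{-λ} λ^k / k!`. -/
def poissonProb (lam : ℝ) (k : ℕ) : ℝ :=
  Real.exp (-lam) * lam ^ k / (k.factorial : ℝ)

/-! ### Finite product Bernoulli expectations -/

section BernoulliExpectation

set_option linter.unusedSectionVars false

variable {ι : Type*} [Fintype ι] [DecidableEq ι]

/-- Real weight of a configuration. -/
def wt (p : ℝ) (S : ι → Bool) : ℝ := ∏ e, if S e then p else 1 - p

/-- Expectation with respect to the product Bernoulli weights. -/
def Ex {E : Type*} [AddCommMonoid E] [Module ℝ E] (p : ℝ) (g : (ι → Bool) → E) : E :=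
  ∑ S, wt p S • g S

lemma wt_nonneg {p : ℝ} (h0 : 0 ≤ p) (h1 : p ≤ 1) (S : ι → Bool) : 0 ≤ wt p S := by
  unfold wt
  refine Finset.prod_nonneg fun e _ => ?_
  split_ifs <;> linarith

lemma sum_wt (p : ℝ) : ∑ S : ι → Bool, wt p S = 1 := by
  unfold wt
  have h := Finset.prod_univ_sum (fun _ : ι => (Finset.univ : Finset Bool))
    (fun _ b => if b then p else 1 - p)
  rw [Fintype.piFinset_univ] at h
  rw [← h]
  simp

lemma Ex_coord (p : ℝ) (a : ι) (φ : Bool → ℝ) :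
    Ex p (fun S : ι → Bool => φ (S a)) = p * φ true + (1 - p) * φ false := by
  unfold Ex wt
  have h := Finset.prod_univ_sum (fun _ : ι => (Finset.univ : Finset Bool))
    (fun e b => (if b then p else 1 - p) * (if e = a then φ b else 1))
  rw [Fintype.piFinset_univ] at h
  have h2 : ∀ S : ι → Bool, (∏ e, ((if S e then p else 1 - p) * (if e = a then φ (S e) else 1)))
      = (∏ e, if S e then p else 1 - p) • φ (S a) := by
    intro S
    rw [Finset.prod_mul_distrib, Finset.prod_ite_eq']
    simp
  simp only [h2] at h
  rw [← h]
  have h3 : ∀ e : ι, ∑ b : Bool, ((if b then p else 1 - p) * (if e = a then φ b else 1))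
      = if e = a then p * φ true + (1 - p) * φ false else 1 := by
    intro e
    split_ifs <;> simp
  simp only [h3]
  simp

variable {E : Type*} [NormedAddCommGroup E] [NormedSpace ℝ E]

lemma Ex_const (p : ℝ) (c : E) : Ex p (fun _ : ι → Bool => c) = c := by
  unfold Ex
  rw [← Finset.sum_smul, sum_wt, one_smul]

lemma Ex_add (p : ℝ) (g h : (ι → Bool) → E) :
    Ex p (fun S => g S + h S) = Ex p g + Ex p h := by
  simp [Ex, Finset.sum_add_distrib]

lemma Ex_sub (p : ℝ) (g h : (ι → Bool) → E) :
    Ex p (fun S => g S - h S) = Ex p g - Ex p h := by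
  simp [Ex, smul_sub, Finset.sum_sub_distrib]

lemma Ex_sum {κ : Type*} (p : ℝ) (s : Finset κ) (g : κ → (ι → Bool) → E) :
    Ex p (fun S => ∑ k ∈ s, g k S) = ∑ k ∈ s, Ex p (g k) := by
  simp only [Ex, Finset.smul_sum]
  rw [Finset.sum_comm]

lemma Ex_mul_left {A : Type*} [NormedRing A] [NormedAlgebra ℝ A] (p : ℝ) (c : A)
    (g : (ι → Bool) → A) : Ex p (fun S => c * g S) = c * Ex p g := by
  simp [Ex, Finset.mul_sum]

lemma Ex_mul_right {A : Type*} [NormedRing A] [NormedAlgebra ℝ A] (p : ℝ) (c : A)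
    (g : (ι → Bool) → A) : Ex p (fun S => g S * c) = Ex p g * c := by
  simp [Ex, Finset.sum_mul]

lemma Ex_ofReal (p : ℝ) (g : (ι → Bool) → ℝ) :
    Ex p (fun S => (g S : ℂ)) = ((Ex p g : ℝ) : ℂ) := by
  simp [Ex]

lemma norm_Ex_le {p : ℝ} (h0 : 0 ≤ p) (h1 : p ≤ 1) (g : (ι → Bool) → E) :
    ‖Ex p g‖ ≤ Ex p (fun S => ‖g S‖) := by
  unfold Ex
  refine (norm_sum_le _ _).trans (Finset.sum_le_sum fun S _ => ?_)
  rw [norm_smul, Real.norm_of_nonneg (wt_nonneg h0 h1 S), smul_eq_mul]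

lemma Ex_mono {p : ℝ} (h0 : 0 ≤ p) (h1 : p ≤ 1) {g h : (ι → Bool) → ℝ} (hgh : ∀ S, g S ≤ h S) :
    Ex p g ≤ Ex p h :=
  Finset.sum_le_sum fun S _ => smul_le_smul_of_nonneg_left (hgh S) (wt_nonneg h0 h1 S)

lemma Ex_nonneg {p : ℝ} (h0 : 0 ≤ p) (h1 : p ≤ 1) {g : (ι → Bool) → ℝ} (hg : ∀ S, 0 ≤ g S) :
    0 ≤ Ex p g :=
  Finset.sum_nonneg fun S _ => smul_nonneg (wt_nonneg h0 h1 S) (hg S)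

lemma Ex_sq_le {p : ℝ} (h0 : 0 ≤ p) (h1 : p ≤ 1) (g : (ι → Bool) → ℝ) :
    (Ex p g) ^ 2 ≤ Ex p (fun S => g S ^ 2) := by
  have h : 0 ≤ Ex p (fun S => (g S - Ex p g) ^ 2) := Ex_nonneg h0 h1 fun S => sq_nonneg _
  have h2 : Ex p (fun S => (g S - Ex p g) ^ 2)
      = Ex p (fun S => g S ^ 2) - (Ex p g) ^ 2 := by
    have : (fun S => (g S - Ex p g) ^ 2)
        = fun S => g S ^ 2 - ((2 * Ex p g) * g S - (Ex p g) ^ 2) := by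
      funext S; ring
    rw [this, Ex_sub, Ex_sub, Ex_mul_left, Ex_const]
    ring
  linarith

/-- Independence of functions of disjoint sets of coordinates. -/
lemma Ex_mul_of_indep {A : Type*} [NormedCommRing A] [NormedAlgebra ℝ A] (p : ℝ)
    {g h : (ι → Bool) → A} {s t : Finset ι} (hst : Disjoint s t)
    (hg : DependsOn g (s : Set ι)) (hh : DependsOn h (t : Set ι)) :
    Ex p (fun S => g S * h S) = Ex p g * Ex p h := by
  classical
  let mix : (ι → Bool) × (ι → Bool) → (ι → Bool) × (ι → Bool) := fun x =>
    (fun i => if i ∈ s then x.1 i else x.2 i, fun i => if i ∈ s then x.2 i else x.1 i)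
  have hmix : Function.Involutive mix := by
    rintro ⟨S, T⟩
    simp only [mix, Prod.mk.injEq]
    constructor <;> funext i <;> by_cases hi : i ∈ s <;> simp [hi]
  have e1 : Ex p g * Ex p h
      = ∑ x : (ι → Bool) × (ι → Bool), (wt p x.1 * wt p x.2) • (g x.1 * h x.2) := by
    unfold Ex
    rw [Finset.sum_mul_sum, Fintype.sum_prod_type]
    refine Finset.sum_congr rfl fun S _ => Finset.sum_congr rfl fun T _ => ?_
    rw [smul_mul_smul_comm]
  have e2 : Ex p (fun S => g S * h S)
      = ∑ x : (ι → Bool) × (ι → Bool), (wt p x.1 * wt p x.2) • (g x.1 * h x.1) := by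
    unfold Ex
    rw [Fintype.sum_prod_type]
    refine Finset.sum_congr rfl fun S _ => ?_
    dsimp only
    rw [← Finset.sum_smul, ← Finset.mul_sum, sum_wt, mul_one]
  rw [e1, e2]
  symm
  refine Fintype.sum_equiv hmix.toPerm _ _ ?_
  rintro ⟨S, T⟩
  have w : wt p (mix (S, T)).1 * wt p (mix (S, T)).2 = wt p S * wt p T := by
    unfold wt
    rw [← Finset.prod_mul_distrib, ← Finset.prod_mul_distrib]
    refine Finset.prod_congr rfl fun i _ => ?_
    by_cases hi : i ∈ s <;> simp [mix, hi, mul_comm]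
  have hg' : g (mix (S, T)).1 = g S := hg fun i hi => by
    have : i ∈ s := hi
    simp [mix, this]
  have hh' : h (mix (S, T)).1 = h T := hh fun i hi => by
    have : i ∉ s := fun h' => Finset.disjoint_left.1 hst h' hi
    simp [mix, this]
  change _ = (wt p (mix (S, T)).1 * wt p (mix (S, T)).2) • (g (mix (S, T)).1 * h (mix (S, T)).1)
  rw [w, hg', hh']

/-- Number of present coordinates in `s`. -/
def cnt (s : Finset ι) (S : ι → Bool) : ℕ := (s.filter fun e => S e = true).card

/-- Indicator of coordinate `a`. -/
def xi (a : ι) (S : ι → Bool) : ℝ := if S a then 1 else 0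

lemma Ex_xi (p : ℝ) (a : ι) : Ex p (xi a) = p := by
  have := Ex_coord p a (fun b => if b then (1 : ℝ) else 0)
  simp only [if_true, Bool.false_eq_true, if_false, mul_one, mul_zero, add_zero] at this
  exact this


lemma cnt_dep {β : Type*} (s : Finset ι) (g : ℕ → β) :
    DependsOn (fun S : ι → Bool => g (cnt s S)) (s : Set ι) := by
  intro x y hxy
  have : cnt s x = cnt s y := by
    unfold cnt
    congr 1
    refine Finset.filter_congr fun e he => ?_
    rw [hxy e he]
  simp only [this]

lemma xi_dep (a : ι) : DependsOn (xi a) (({a} : Finset ι) : Set ι) := by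
  intro x y hxy
  unfold xi
  rw [hxy a (by simp)]

lemma cnt_insert {a : ι} {s : Finset ι} (ha : a ∉ s) (S : ι → Bool) :
    cnt (insert a s) S = cnt s S + if S a then 1 else 0 := by
  unfold cnt
  rw [Finset.filter_insert]
  split_ifs with h
  · rw [Finset.card_insert_of_notMem (by simp [ha])]
  · simp

lemma apply_cnt_insert {a : ι} {s : Finset ι} (ha : a ∉ s) (g : ℕ → ℝ) (S : ι → Bool) :
    g (cnt (insert a s) S) = g (cnt s S) + xi a S * (g (cnt s S + 1) - g (cnt s S)) := by
  rw [cnt_insert ha]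
  unfold xi
  split_ifs <;> simp

lemma cnt_eq_sum (s : Finset ι) (S : ι → Bool) : (cnt s S : ℝ) = ∑ e ∈ s, xi e S := by
  unfold cnt xi
  rw [Finset.card_filter]
  push_cast
  rfl

/-- Binomial expectation. -/
def Bn (p : ℝ) : ℕ → (ℕ → ℝ) → ℝ
  | 0, g => g 0
  | m + 1, g => p * Bn p m (fun k => g (k + 1)) + (1 - p) * Bn p m g

lemma Ex_cnt (p : ℝ) (s : Finset ι) (g : ℕ → ℝ) :
    Ex p (fun S => g (cnt s S)) = Bn p s.card g := by
  induction s using Finset.induction_on generalizing g with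
  | empty => simp [cnt, Bn, Ex_const]
  | insert a s ha ih =>
    rw [Finset.card_insert_of_notMem ha]
    have hd : Disjoint ({a} : Finset ι) s := by simpa using ha
    simp only [apply_cnt_insert ha]
    rw [Ex_add, ih, Ex_mul_of_indep p hd (xi_dep a) (cnt_dep s fun k => g (k + 1) - g k),
      Ex_sub, ih, ih (fun k => g (k + 1)), Ex_xi, Bn]
    ring

lemma Bn_add (p : ℝ) (m : ℕ) (g h : ℕ → ℝ) :
    Bn p m (fun k => g k + h k) = Bn p m g + Bn p m h := by
  induction m generalizing g h with
  | zero => rfl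
  | succ m ih => simp only [Bn, ih]; ring

lemma Bn_mul_left (p : ℝ) (m : ℕ) (c : ℝ) (g : ℕ → ℝ) :
    Bn p m (fun k => c * g k) = c * Bn p m g := by
  induction m generalizing g with
  | zero => rfl
  | succ m ih => simp only [Bn, ih]; ring

lemma Bn_sub (p : ℝ) (m : ℕ) (g h : ℕ → ℝ) :
    Bn p m (fun k => g k - h k) = Bn p m g - Bn p m h := by
  have := Bn_add p m g (fun k => (-1) * h k)
  rw [Bn_mul_left] at this
  rw [sub_eq_add_neg, ← neg_one_mul, ← this]
  congr 1; funext k; ring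

lemma Bn_const (p : ℝ) (m : ℕ) (c : ℝ) : Bn p m (fun _ => c) = c := by
  induction m with
  | zero => rfl
  | succ m ih => simp only [Bn, ih]; ring

lemma Bn_mono {p : ℝ} (h0 : 0 ≤ p) (h1 : p ≤ 1) (m : ℕ) {g h : ℕ → ℝ} (hgh : ∀ k, g k ≤ h k) :
    Bn p m g ≤ Bn p m h := by
  induction m generalizing g h with
  | zero => exact hgh 0
  | succ m ih =>
    simp only [Bn]
    have := ih (g := fun k => g (k+1)) (h := fun k => h (k+1)) fun k => hgh _
    have := ih hgh
    have : 0 ≤ 1 - p := by linarith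
    gcongr

lemma abs_Bn_le {p : ℝ} (h0 : 0 ≤ p) (h1 : p ≤ 1) (m : ℕ) (g : ℕ → ℝ) :
    |Bn p m g| ≤ Bn p m (fun k => |g k|) := by
  rw [abs_le]
  constructor
  · have := Bn_mono h0 h1 m (g := fun k => (-1) * |g k|) (h := g)
      fun k => by linarith [neg_abs_le (g k)]
    rw [Bn_mul_left] at this
    linarith
  · exact Bn_mono h0 h1 m fun k => le_abs_self _

/-- Binomial point probabilities. -/
def bpmf (p : ℝ) (m k : ℕ) : ℝ := (m.choose k : ℝ) * p ^ k * (1 - p) ^ (m - k)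

lemma bpmf_succ_succ (p : ℝ) (m k : ℕ) :
    bpmf p (m + 1) (k + 1) = p * bpmf p m k + (1 - p) * bpmf p m (k + 1) := by
  unfold bpmf
  rw [Nat.choose_succ_succ]
  rcases lt_or_ge k m with h | h
  · obtain ⟨j, rfl⟩ : ∃ j, m = k + 1 + j := ⟨m - (k+1), by omega⟩
    have e1 : k + 1 + j + 1 - (k + 1) = j + 1 := by omega
    have e2 : k + 1 + j - k = j + 1 := by omega
    have e3 : k + 1 + j - (k + 1) = j := by omega
    rw [e1, e2, e3]
    push_cast
    ring
  · have e : m.choose (k + 1) = 0 := Nat.choose_eq_zero_of_lt (by omega)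
    rw [e]
    have e1 : m + 1 - (k + 1) = m - k := by omega
    rw [e1]
    push_cast
    ring

lemma Bn_eq_sum (p : ℝ) (m N : ℕ) (hN : m < N) (g : ℕ → ℝ) :
    Bn p m g = ∑ k ∈ Finset.range N, bpmf p m k * g k := by
  induction m generalizing g N with
  | zero =>
    rw [Finset.sum_eq_single 0]
    · simp [Bn, bpmf]
    · intro b _ hb
      simp [bpmf, Nat.choose_eq_zero_of_lt (Nat.pos_of_ne_zero hb)]
    · intro h; simp at h; omega
  | succ m ih =>
    obtain ⟨N, rfl⟩ : ∃ N', N = N' + 1 := ⟨N - 1, by omega⟩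
    rw [Finset.sum_range_succ', Bn, ih N (by omega), ih (N + 1) (by omega),
      Finset.sum_range_succ']
    have e0 : bpmf p (m + 1) 0 = (1 - p) * bpmf p m 0 := by
      simp [bpmf, pow_succ]; ring
    simp only [bpmf_succ_succ, e0, add_mul, Finset.sum_add_distrib, mul_add, Finset.mul_sum,
      mul_assoc]
    ring

end BernoulliExpectation

/-! ### Covariances of counts -/

section Covariance

set_option linter.unusedSectionVars false

variable {ι : Type*} [Fintype ι] [DecidableEq ι]

lemma Ex_cov (p : ℝ) {s t : Finset ι} {a : ι} (has : a ∉ s) (hat : a ∉ t) (hst : Disjoint s t)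
    {M : ℕ} (hs : s.card = M) (ht : t.card = M) (g : ℕ → ℝ) :
    Ex p (fun S => g (cnt (insert a s) S) * g (cnt (insert a t) S))
      = p * Bn p M (fun k => g (k + 1)) ^ 2 + (1 - p) * Bn p M g ^ 2 := by
  have h1 : ∀ h : ℕ → ℝ, Ex p (fun S => h (cnt s S) * h (cnt t S)) = Bn p M h ^ 2 := by
    intro h
    rw [Ex_mul_of_indep p hst (cnt_dep s h) (cnt_dep t h), Ex_cnt, Ex_cnt, hs, ht, sq]
  have hpt : (fun S => g (cnt (insert a s) S) * g (cnt (insert a t) S))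
      = fun S => g (cnt s S) * g (cnt t S) + xi a S *
        (g (cnt s S + 1) * g (cnt t S + 1) - g (cnt s S) * g (cnt t S)) := by
    funext S
    rw [cnt_insert has, cnt_insert hat]
    unfold xi
    split_ifs <;> simp
  have hd : Disjoint ({a} : Finset ι) (s ∪ t) := by simp [has, hat]
  have hdep : DependsOn (fun S : ι → Bool =>
      (g (cnt s S + 1) * g (cnt t S + 1) - g (cnt s S) * g (cnt t S)))
      ((s ∪ t : Finset ι) : Set ι) := by
    intro x y hxy
    have e1 : cnt s x = cnt s y := cnt_dep s id fun i hi => hxy i (by simpa using Or.inl hi)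
    have e2 : cnt t x = cnt t y := cnt_dep t id fun i hi => hxy i (by simpa using Or.inr hi)
    simp only [e1, e2]
  rw [hpt, Ex_add, Ex_mul_of_indep p hd (xi_dep a) hdep, Ex_sub, Ex_xi, h1 g,
    h1 (fun k => g (k + 1))]
  ring

/-- Forward difference. -/
def fd (g : ℕ → ℝ) (k : ℕ) : ℝ := g (k + 1) - g k

lemma Bn_fd (p : ℝ) (M : ℕ) (g : ℕ → ℝ) :
    Bn p M (fd g) = Bn p M (fun k => g (k + 1)) - Bn p M g := by
  unfold fd
  rw [Bn_sub]

lemma Ex_cov' (p : ℝ) {s t : Finset ι} {M : ℕ} (hs : s.card = M + 1) (ht : t.card = M + 1)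
    (hst : (s ∩ t).card = 1) (g : ℕ → ℝ) :
    Ex p (fun S => (g (cnt s S) - Bn p (M + 1) g) * (g (cnt t S) - Bn p (M + 1) g))
      = p * (1 - p) * Bn p M (fd g) ^ 2 := by
  obtain ⟨a, ha⟩ := Finset.card_eq_one.1 hst
  have ha' : a ∈ s ∩ t := by rw [ha]; simp
  have has : a ∈ s := (Finset.mem_inter.1 ha').1
  have hat : a ∈ t := (Finset.mem_inter.1 ha').2
  have h := Ex_cov p (s := s.erase a) (t := t.erase a) (a := a) (by simp) (by simp) ?_
    (M := M) ?_ ?_ (fun k => g k - Bn p (M + 1) g)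
  · rw [Finset.insert_erase has, Finset.insert_erase hat] at h
    rw [h, Bn_sub, Bn_sub, Bn_const, Bn_fd, Bn]
    ring
  · rw [Finset.disjoint_left]
    intro b hb hb'
    have hb1 : b ∈ s ∩ t := Finset.mem_inter.2
      ⟨Finset.mem_of_mem_erase hb, Finset.mem_of_mem_erase hb'⟩
    rw [ha] at hb1
    exact (Finset.ne_of_mem_erase hb) (by simpa using hb1)
  · rw [Finset.card_erase_of_mem has, hs]; rfl
  · rw [Finset.card_erase_of_mem hat, ht]; rfl

lemma Ex_var (p : ℝ) {s : Finset ι} {M : ℕ} (hs : s.card = M) (g : ℕ → ℝ) :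
    Ex p (fun S => (g (cnt s S) - Bn p M g) * (g (cnt s S) - Bn p M g))
      = Bn p M (fun k => g k ^ 2) - Bn p M g ^ 2 := by
  have := Ex_cnt p s (fun k => (g k - Bn p M g) * (g k - Bn p M g))
  rw [this, hs]
  have e : (fun k => (g k - Bn p M g) * (g k - Bn p M g))
      = fun k => g k ^ 2 - ((2 * Bn p M g) * g k - Bn p M g ^ 2) := by
    funext k; ring
  rw [e, Bn_sub, Bn_sub, Bn_mul_left, Bn_const]
  ring

lemma Ex_sum_sq {κ : Type*} [DecidableEq κ] (p : ℝ) (U : Finset κ) (Ed : κ → Finset ι) {M : ℕ}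
    (hcard : ∀ u ∈ U, (Ed u).card = M + 1)
    (hinter : ∀ u ∈ U, ∀ w ∈ U, u ≠ w → (Ed u ∩ Ed w).card = 1) (g : ℕ → ℝ) :
    Ex p (fun S => (∑ u ∈ U, (g (cnt (Ed u) S) - Bn p (M + 1) g)) ^ 2)
      = U.card * (Bn p (M + 1) (fun k => g k ^ 2) - Bn p (M + 1) g ^ 2)
        + U.card * (U.card - 1) * (p * (1 - p) * Bn p M (fd g) ^ 2) := by
  simp only [sq (∑ u ∈ U, _), Finset.sum_mul_sum]
  rw [Ex_sum]
  have key : ∀ u ∈ U, Ex p (fun S => ∑ w ∈ U,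
      (g (cnt (Ed u) S) - Bn p (M + 1) g) * (g (cnt (Ed w) S) - Bn p (M + 1) g))
      = (Bn p (M + 1) (fun k => g k ^ 2) - Bn p (M + 1) g ^ 2)
        + (U.card - 1) * (p * (1 - p) * Bn p M (fd g) ^ 2) := by
    intro u hu
    rw [Ex_sum, ← Finset.add_sum_erase _ _ hu, Ex_var p (hcard u hu)]
    congr 1
    rw [Finset.sum_congr rfl (g := fun _ => p * (1 - p) * Bn p M (fd g) ^ 2)]
    · rw [Finset.sum_const, Finset.card_erase_of_mem hu, nsmul_eq_mul,
        Nat.cast_pred (Finset.card_pos.2 ⟨u, hu⟩)]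
    · intro w hw
      exact Ex_cov' p (hcard u hu) (hcard w (Finset.mem_of_mem_erase hw))
        (hinter u hu w (Finset.mem_of_mem_erase hw) (Finset.ne_of_mem_erase hw).symm) g
  rw [Finset.sum_congr rfl key, Finset.sum_const, nsmul_eq_mul]
  ring

lemma Bn_id (p : ℝ) (m : ℕ) : Bn p m (fun k => (k : ℝ)) = m * p := by
  induction m with
  | zero => simp [Bn]
  | succ m ih =>
    simp only [Bn]
    push_cast
    rw [Bn_add p m (fun k => (k : ℝ)) (fun _ => 1), Bn_const, ih]
    ring

lemma Bn_sq_id (p : ℝ) (m : ℕ) :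
    Bn p m (fun k => (k : ℝ) ^ 2) = m * p * (1 - p) + (m * p) ^ 2 := by
  induction m with
  | zero => simp [Bn]
  | succ m ih =>
    simp only [Bn]
    have e : (fun k : ℕ => ((k + 1 : ℕ) : ℝ) ^ 2) = fun k : ℕ => (k : ℝ) ^ 2 + (2 * (k : ℝ) + 1) := by
      funext k; push_cast; ring
    rw [e, Bn_add, Bn_add p m (fun k => 2 * (k : ℝ)) (fun _ => 1), Bn_mul_left, Bn_const, ih, Bn_id]
    push_cast
    ring

lemma Bn_one_add_sq {p L : ℝ} (h0 : 0 ≤ p) (h1 : p ≤ 1) {m : ℕ} (hL : m * p ≤ L) :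
    Bn p m (fun k => (1 + (k : ℝ)) ^ 2) ≤ 1 + 3 * L + L ^ 2 := by
  have e : (fun k : ℕ => (1 + (k : ℝ)) ^ 2) = fun k : ℕ => (k : ℝ) ^ 2 + (2 * (k : ℝ) + 1) := by
    funext k; ring
  rw [e, Bn_add, Bn_add p m (fun k => 2 * (k : ℝ)) (fun _ => 1), Bn_mul_left, Bn_const, Bn_sq_id,
    Bn_id]
  have h2 : 0 ≤ m * p := by positivity
  nlinarith [mul_nonneg h2 h0]

lemma abs_Bn_le_const {p B : ℝ} (h0 : 0 ≤ p) (h1 : p ≤ 1) (m : ℕ) {g : ℕ → ℝ}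
    (hg : ∀ k, |g k| ≤ B) : |Bn p m g| ≤ B := by
  refine (abs_Bn_le h0 h1 m g).trans ?_
  refine (Bn_mono h0 h1 m hg).trans ?_
  rw [Bn_const]

lemma abs_fd_le {B : ℝ} {g : ℕ → ℝ} (hg : ∀ k, |g k| ≤ B) (k : ℕ) : |fd g k| ≤ 2 * B := by
  unfold fd
  refine (abs_sub _ _).trans ?_
  linarith [hg k, hg (k + 1)]

end Covariance

/-! ### The incidence structure -/

section Incidence

/-- Edges at `v`. -/
def inc (n : ℕ) (v : Fin n) : Finset (EdgeIdx n) :=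
  Finset.univ.filter fun e => v ∈ (e : Sym2 (Fin n))

lemma mem_inc {n : ℕ} {v : Fin n} {e : EdgeIdx n} : e ∈ inc n v ↔ v ∈ (e : Sym2 (Fin n)) := by
  simp [inc]

/-- The edge joining two distinct vertices. -/
def edge {n : ℕ} (u v : Fin n) (h : u ≠ v) : EdgeIdx n := ⟨s(u, v), by simpa using h⟩

lemma degree_eq_cnt (n : ℕ) (S : EdgeIdx n → Bool) (v : Fin n) :
    degree n S v = cnt (inc n v) S := by
  unfold degree cnt inc
  rw [Finset.filter_filter]
  congr 1
  ext e
  simp [and_comm]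

lemma card_inc (n : ℕ) (v : Fin n) : (inc n v).card = n - 1 := by
  have : (Finset.univ.erase v : Finset (Fin n)).card = n - 1 := by
    rw [Finset.card_erase_of_mem (Finset.mem_univ v)]; simp
  rw [← this]
  symm
  refine Finset.card_bij (fun u hu => edge u v (Finset.ne_of_mem_erase hu)) ?_ ?_ ?_
  · intro u hu
    simp [mem_inc, edge]
  · intro u hu w hw h
    have h' : u = w ∨ u = v ∧ v = w := by simpa [edge, Subtype.ext_iff] using h
    rcases h' with h' | ⟨h', h''⟩
    · exact h'
    · exact h'.trans h''
  · rintro ⟨e, he⟩ hv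
    rw [mem_inc] at hv
    obtain ⟨u, rfl⟩ := Sym2.mem_iff_exists.1 hv
    refine ⟨u, ?_, ?_⟩
    · simp at he
      simp [Ne.symm he]
    · simp [edge, Sym2.eq_swap]

lemma inc_inter {n : ℕ} (u v : Fin n) (h : u ≠ v) : inc n u ∩ inc n v = {edge u v h} := by
  ext ⟨e, he⟩
  simp only [Finset.mem_inter, mem_inc, Finset.mem_singleton, edge, Subtype.mk.injEq]
  exact Sym2.mem_and_mem_iff h

lemma edge_mem_left {n : ℕ} (u v : Fin n) (h : u ≠ v) : edge u v h ∈ inc n u := by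
  simp [mem_inc, edge]

lemma edge_mem_right {n : ℕ} (u v : Fin n) (h : u ≠ v) : edge u v h ∈ inc n v := by
  simp [mem_inc, edge]

lemma inc_insert {n : ℕ} (u v : Fin n) (h : u ≠ v) :
    insert (edge u v h) (inc n u \ inc n v) = inc n u := by
  have : inc n u \ inc n v = (inc n u).erase (edge u v h) := by
    rw [← Finset.sdiff_inter_self_left, inc_inter u v h, Finset.sdiff_singleton_eq_erase]
  rw [this, Finset.insert_erase (edge_mem_left u v h)]

lemma edge_notMem {n : ℕ} (u v : Fin n) (h : u ≠ v) : edge u v h ∉ inc n u \ inc n v := by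
  simp [edge_mem_right]

lemma card_inc_sdiff {n : ℕ} (u v : Fin n) (h : u ≠ v) : (inc n u \ inc n v).card = n - 2 := by
  have h1 := congrArg Finset.card (inc_insert u v h)
  rw [Finset.card_insert_of_notMem (edge_notMem u v h), card_inc] at h1
  omega

lemma card_inc_sdiff_inter {n : ℕ} (u w v : Fin n) (hu : u ≠ v) (hw : w ≠ v) (huw : u ≠ w) :
    ((inc n u \ inc n v) ∩ (inc n w \ inc n v)).card = 1 := by
  rw [Finset.card_eq_one]
  refine ⟨edge u w huw, ?_⟩
  have h := inc_inter u w huw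
  have h2 : edge u w huw ∉ inc n v := by simp [mem_inc, edge, hu.symm, hw.symm]
  ext e
  have he := congrArg (fun s => e ∈ s) h
  simp only [Finset.mem_inter, Finset.mem_singleton, eq_iff_iff] at he
  simp only [Finset.mem_inter, Finset.mem_sdiff, Finset.mem_singleton]
  constructor
  · rintro ⟨⟨h3, _⟩, h4, _⟩
    exact he.1 ⟨h3, h4⟩
  · intro h5
    have h6 := he.2 h5
    subst h5
    exact ⟨⟨h6.1, h2⟩, h6.2, h2⟩

end Incidence

/-! ### Vertex removal -/

section VertexRemoval

/-- `x ↦ e^{ix}`. -/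
def eit (x : ℝ) : ℂ := Complex.exp (Complex.I * x)

lemma norm_eit (x : ℝ) : ‖eit x‖ = 1 := Complex.norm_exp_I_mul_ofReal x

lemma eit_add (x y : ℝ) : eit (x + y) = eit x * eit y := by
  unfold eit
  rw [← Complex.exp_add]
  push_cast
  ring_nf

lemma norm_eit_sub_one (x : ℝ) : ‖eit x - 1‖ ≤ |x| := Real.norm_exp_I_mul_ofReal_sub_one_le

lemma norm_eit_sub_one_sub (x : ℝ) : ‖eit x - 1 - Complex.I * x‖ ≤ 3 * x ^ 2 := by
  have hn : ‖Complex.I * (x : ℂ)‖ = |x| := by simp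
  rcases le_or_gt |x| 1 with h | h
  · have := Complex.norm_exp_sub_one_sub_id_le (x := Complex.I * (x : ℂ)) (by rw [hn]; exact h)
    rw [hn, sq_abs] at this
    unfold eit
    nlinarith [sq_nonneg x]
  · have h1 := norm_sub_le (eit x - 1) (Complex.I * x)
    rw [hn] at h1
    have h2 := norm_eit_sub_one x
    have : |x| ≤ x ^ 2 := by rw [← sq_abs]; nlinarith
    nlinarith [sq_nonneg x]

lemma norm_eit_sub (x y : ℝ) : ‖eit x - eit y‖ ≤ |x - y| := by
  have : eit x - eit y = eit y * (eit (x - y) - 1) := by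
    rw [mul_sub, ← eit_add]; simp
  rw [this, norm_mul, norm_eit, one_mul]
  exact norm_eit_sub_one _

/-- Indicator of the edge `uv`. -/
def xiv {n : ℕ} (v u : Fin n) (S : EdgeIdx n → Bool) : ℝ :=
  if h : u ≠ v then xi (edge u v h) S else 0

lemma sum_xiv {n : ℕ} (v : Fin n) (S : EdgeIdx n → Bool) :
    ∑ u ∈ Finset.univ.erase v, xiv v u S = cnt (inc n v) S := by
  rw [cnt_eq_sum]
  refine Finset.sum_bij (fun u hu => edge u v (Finset.ne_of_mem_erase hu)) ?_ ?_ ?_ ?_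
  · intro u hu
    exact edge_mem_right _ _ _
  · intro u hu w hw h
    have h' : u = w ∨ u = v ∧ v = w := by simpa [edge, Subtype.ext_iff] using h
    rcases h' with h' | ⟨h', h''⟩
    · exact h'
    · exact h'.trans h''
  · rintro ⟨e, he⟩ hv
    rw [mem_inc] at hv
    obtain ⟨u, rfl⟩ := Sym2.mem_iff_exists.1 hv
    refine ⟨u, ?_, ?_⟩
    · simp at he
      simp [Ne.symm he]
    · simp [edge, Sym2.eq_swap]
  · intro u hu
    have : u ≠ v := Finset.ne_of_mem_erase hu
    simp [xiv, this]

lemma xiv_nonneg {n : ℕ} (v u : Fin n) (S : EdgeIdx n → Bool) : 0 ≤ xiv v u S := by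
  unfold xiv xi
  split_ifs <;> norm_num

lemma xiv_dep {n : ℕ} (v u : Fin n) : DependsOn (xiv v u) ((inc n v : Finset _) : Set (EdgeIdx n)) := by
  intro x y hxy
  unfold xiv
  split_ifs with h
  · unfold xi
    rw [hxy _ (edge_mem_right u v h)]
  · rfl

/-- Degree of `u` after deleting `v`. -/
def dg' {n : ℕ} (v u : Fin n) (S : EdgeIdx n → Bool) : ℕ := cnt (inc n u \ inc n v) S

lemma dg'_dep {n : ℕ} {β : Type*} (v u : Fin n) (g : ℕ → β) :
    DependsOn (fun S => g (dg' v u S)) (((inc n v)ᶜ : Finset _) : Set (EdgeIdx n)) := by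
  refine (cnt_dep (inc n u \ inc n v) g).mono ?_
  intro e he
  simp only [Finset.coe_sdiff, Set.mem_sdiff] at he
  simpa using he.2

/-- Normalized centred sum. -/
def Xn (n : ℕ) (p : ℝ) (f : ℕ → ℝ) (S : EdgeIdx n → Bool) : ℝ :=
  (Real.sqrt n)⁻¹ * (∑ v, f (cnt (inc n v) S) - n * Bn p (n - 1) f)

/-- The part of `Xn` that does not depend on edges at `v`. -/
def Xp (n : ℕ) (p : ℝ) (f : ℕ → ℝ) (v : Fin n) (S : EdgeIdx n → Bool) : ℝ :=
  (Real.sqrt n)⁻¹ * (∑ u ∈ Finset.univ.erase v, f (dg' v u S) - n * Bn p (n - 1) f)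

/-- The part of the sum that depends on edges at `v`. -/
def Rv (n : ℕ) (f : ℕ → ℝ) (v : Fin n) (S : EdgeIdx n → Bool) : ℝ :=
  f (cnt (inc n v) S) + ∑ u ∈ Finset.univ.erase v, xiv v u S * fd f (dg' v u S)

lemma Xn_eq (n : ℕ) (p : ℝ) (f : ℕ → ℝ) (v : Fin n) (S : EdgeIdx n → Bool) :
    Xn n p f S = Xp n p f v S + (Real.sqrt n)⁻¹ * Rv n f v S := by
  unfold Xn Xp Rv
  rw [← mul_add, ← Finset.add_sum_erase _ _ (Finset.mem_univ v)]
  have : ∀ u ∈ Finset.univ.erase v, f (cnt (inc n u) S)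
      = f (dg' v u S) + xiv v u S * fd f (dg' v u S) := by
    intro u hu
    have h : u ≠ v := Finset.ne_of_mem_erase hu
    have h2 := apply_cnt_insert (edge_notMem u v h) f S
    rw [inc_insert] at h2
    rw [h2]
    simp [xiv, h, dg', fd]
  rw [Finset.sum_congr rfl this, Finset.sum_add_distrib]
  ring

lemma Xp_dep {n : ℕ} (p : ℝ) (f : ℕ → ℝ) (v : Fin n) {β : Type*} (φ : ℝ → β) :
    DependsOn (fun S => φ (Xp n p f v S)) (((inc n v)ᶜ : Finset _) : Set (EdgeIdx n)) := by
  intro x y hxy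
  have : ∀ u, f (dg' v u x) = f (dg' v u y) := fun u => dg'_dep v u f hxy
  simp only [Xp, this]

lemma abs_Rv_le {n : ℕ} {f : ℕ → ℝ} {B : ℝ} (hf : ∀ k, |f k| ≤ B) (v : Fin n)
    (S : EdgeIdx n → Bool) : |Rv n f v S| ≤ 2 * B * (1 + cnt (inc n v) S) := by
  have hB : 0 ≤ B := (abs_nonneg _).trans (hf 0)
  unfold Rv
  have h1 : |∑ u ∈ Finset.univ.erase v, xiv v u S * fd f (dg' v u S)|
      ≤ ∑ u ∈ Finset.univ.erase v, xiv v u S * (2 * B) := by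
    refine (Finset.abs_sum_le_sum_abs _ _).trans (Finset.sum_le_sum fun u _ => ?_)
    rw [abs_mul, abs_of_nonneg (xiv_nonneg v u S)]
    exact mul_le_mul_of_nonneg_left (abs_fd_le hf _) (xiv_nonneg v u S)
  rw [← Finset.sum_mul, sum_xiv] at h1
  refine (abs_add_le _ _).trans ?_
  linarith [hf (cnt (inc n v) S)]

lemma Ex_Z_xiv {n : ℕ} (hn : 2 ≤ n) (p : ℝ) (f : ℕ → ℝ) (v u : Fin n) (h : u ≠ v) :
    Ex p (fun S => (f (cnt (inc n v) S) - Bn p (n - 1) f) * xiv v u S)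
      = p * (1 - p) * Bn p (n - 2) (fd f) := by
  have e : edge u v h = edge v u h.symm := by simp [edge, Sym2.eq_swap]
  have hpt : (fun S => (f (cnt (inc n v) S) - Bn p (n - 1) f) * xiv v u S)
      = fun S => xi (edge v u h.symm) S *
        (fun k => f (k + 1) - Bn p (n - 1) f) (cnt (inc n v \ inc n u) S) := by
    funext S
    have h2 := apply_cnt_insert (edge_notMem v u h.symm) f S
    rw [inc_insert] at h2
    rw [h2]
    simp only [xiv, h, e, ne_eq, not_false_eq_true, dite_true]
    unfold xi
    split_ifs <;> simp
  have hd : Disjoint ({edge v u h.symm} : Finset (EdgeIdx n)) (inc n v \ inc n u) := by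
    rw [Finset.disjoint_singleton_left]
    exact edge_notMem v u h.symm
  rw [hpt, Ex_mul_of_indep p hd (xi_dep _)
    (cnt_dep (inc n v \ inc n u) (fun k => f (k + 1) - Bn p (n - 1) f)), Ex_xi,
    Ex_cnt p (inc n v \ inc n u) (fun k => f (k + 1) - Bn p (n - 1) f), card_inc_sdiff v u h.symm,
    Bn_sub, Bn_const, Bn_fd, show n - 1 = (n - 2) + 1 by omega, Bn]
  ring

lemma Ex_Z_f {n : ℕ} (p : ℝ) (f : ℕ → ℝ) (v : Fin n) :
    Ex p (fun S => (f (cnt (inc n v) S) - Bn p (n - 1) f) * f (cnt (inc n v) S))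
      = Bn p (n - 1) (fun k => f k ^ 2) - Bn p (n - 1) f ^ 2 := by
  rw [Ex_cnt p (inc n v) (fun k => (f k - Bn p (n - 1) f) * f k), card_inc]
  have e : (fun k => (f k - Bn p (n - 1) f) * f k)
      = fun k => f k ^ 2 - Bn p (n - 1) f * f k := by
    funext k; ring
  rw [e, Bn_sub, Bn_mul_left]
  ring

lemma Ex_Z {n : ℕ} (p : ℝ) (f : ℕ → ℝ) (v : Fin n) :
    Ex p (fun S => (f (cnt (inc n v) S) - Bn p (n - 1) f)) = 0 := by
  rw [Ex_cnt p (inc n v) (fun k => (f k - Bn p (n - 1) f)), card_inc, Bn_sub, Bn_const, sub_self]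

lemma Ex_Y_sq {n : ℕ} (hn : 3 ≤ n) {p B L : ℝ} (h0 : 0 ≤ p) (h1 : p ≤ 1) (hL : n * p ≤ L)
    {f : ℕ → ℝ} (hf : ∀ k, |f k| ≤ B) (v : Fin n) :
    Ex p (fun S => (∑ u ∈ Finset.univ.erase v, (fd f (dg' v u S) - Bn p (n - 2) (fd f))) ^ 2)
      ≤ n * (4 * B ^ 2 * (1 + 4 * L)) := by
  have hB : 0 ≤ B := (abs_nonneg _).trans (hf 0)
  have h := Ex_sum_sq p (Finset.univ.erase v) (fun u => inc n u \ inc n v) (M := n - 3)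
    (fun u hu => by
      rw [card_inc_sdiff u v (Finset.ne_of_mem_erase hu)]; omega)
    (fun u hu w hw huw => card_inc_sdiff_inter u w v (Finset.ne_of_mem_erase hu)
      (Finset.ne_of_mem_erase hw) huw) (fd f)
  rw [show n - 3 + 1 = n - 2 by omega] at h
  unfold dg'
  rw [h, Finset.card_erase_of_mem (Finset.mem_univ v), Finset.card_univ, Fintype.card_fin,
    Nat.cast_pred (by omega)]
  have hn' : (3 : ℝ) ≤ n := by exact_mod_cast hn
  have b1 : Bn p (n - 2) (fun k => fd f k ^ 2) ≤ 4 * B ^ 2 := by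
    have := Bn_mono h0 h1 (n - 2) (g := fun k => fd f k ^ 2) (h := fun _ => 4 * B ^ 2) fun k => by
      rw [← sq_abs]
      nlinarith [abs_fd_le hf k, abs_nonneg (fd f k)]
    rwa [Bn_const] at this
  have b2 : Bn p (n - 3) (fd (fd f)) ^ 2 ≤ 16 * B ^ 2 := by
    have := abs_Bn_le_const h0 h1 (n - 3) (abs_fd_le (abs_fd_le hf))
    rw [← sq_abs]
    nlinarith [abs_nonneg (Bn p (n - 3) (fd (fd f)))]
  have b3 : ((n : ℝ) - 1) * (Bn p (n - 2) (fun k => fd f k ^ 2) - Bn p (n - 2) (fd f) ^ 2)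
      ≤ n * (4 * B ^ 2) := by
    have h4 : Bn p (n - 2) (fun k => fd f k ^ 2) - Bn p (n - 2) (fd f) ^ 2 ≤ 4 * B ^ 2 := by
      linarith [sq_nonneg (Bn p (n - 2) (fd f))]
    have h5 : 0 ≤ 4 * B ^ 2 := by positivity
    nlinarith
  have b4 : ((n : ℝ) - 1) * ((n : ℝ) - 1 - 1) * (p * (1 - p) * Bn p (n - 3) (fd (fd f)) ^ 2)
      ≤ n * (L * (16 * B ^ 2)) := by
    have c1 : ((n : ℝ) - 1) * ((n : ℝ) - 1 - 1) ≤ n * n := by nlinarith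
    have c2 : p * (1 - p) * Bn p (n - 3) (fd (fd f)) ^ 2 ≤ p * (16 * B ^ 2) := by
      have : p * (1 - p) ≤ p := by nlinarith
      have h6 : 0 ≤ p * (1 - p) := mul_nonneg h0 (by linarith)
      exact mul_le_mul this b2 (sq_nonneg _) h0
    have c3 : 0 ≤ p * (1 - p) * Bn p (n - 3) (fd (fd f)) ^ 2 :=
      mul_nonneg (mul_nonneg h0 (by linarith)) (sq_nonneg _)
    calc _ ≤ (n * n : ℝ) * (p * (16 * B ^ 2)) := mul_le_mul c1 c2 c3 (by positivity)
      _ = n * ((n * p) * (16 * B ^ 2)) := by ring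
      _ ≤ n * (L * (16 * B ^ 2)) := by gcongr
  linarith

lemma Ex_one_add_deg_sq {n : ℕ} {p L : ℝ} (h0 : 0 ≤ p) (h1 : p ≤ 1) (hL : n * p ≤ L)
    (v : Fin n) : Ex p (fun S => (1 + (cnt (inc n v) S : ℝ)) ^ 2) ≤ 1 + 3 * L + L ^ 2 := by
  rw [Ex_cnt p (inc n v) (fun k => (1 + (k : ℝ)) ^ 2), card_inc]
  refine Bn_one_add_sq h0 h1 (le_trans ?_ hL)
  have : ((n - 1 : ℕ) : ℝ) ≤ n := by exact_mod_cast Nat.sub_le n 1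
  gcongr

end VertexRemoval

/-! ### The Stein-Tikhomirov step -/

section SteinStep

/-- The approximate variance. -/
def sigN (n : ℕ) (p : ℝ) (f : ℕ → ℝ) : ℝ :=
  (Bn p (n - 1) (fun k => f k ^ 2) - Bn p (n - 1) f ^ 2)
    + ((n : ℝ) - 1) * (p * (1 - p)) * Bn p (n - 2) (fd f) ^ 2

lemma Ex_ZR {n : ℕ} (hn : 3 ≤ n) (p : ℝ) (f : ℕ → ℝ) (v : Fin n) (t : ℝ) :
    Ex p (fun S => (((f (cnt (inc n v) S) - Bn p (n - 1) f) * Rv n f v S : ℝ) : ℂ)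
        * eit (t * Xp n p f v S))
      = (sigN n p f : ℂ) * Ex p (fun S => eit (t * Xp n p f v S))
        + ((p * (1 - p) * Bn p (n - 2) (fd f) : ℝ) : ℂ) *
          Ex p (fun S => ((∑ u ∈ Finset.univ.erase v,
            (fd f (dg' v u S) - Bn p (n - 2) (fd f)) : ℝ) : ℂ) * eit (t * Xp n p f v S)) := by
  set μ := Bn p (n - 1) f with hμ
  set δ := Bn p (n - 2) (fd f) with hδ
  set φ : (EdgeIdx n → Bool) → ℂ := fun S => eit (t * Xp n p f v S) with hφ
  have hφd : DependsOn φ (((inc n v)ᶜ : Finset _) : Set (EdgeIdx n)) :=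
    Xp_dep p f v (fun x => eit (t * x))
  have hdisj : Disjoint (inc n v) (inc n v)ᶜ := disjoint_compl_right
  have hpt : (fun S => (((f (cnt (inc n v) S) - μ) * Rv n f v S : ℝ) : ℂ) * φ S)
      = fun S => (((f (cnt (inc n v) S) - μ) * f (cnt (inc n v) S) : ℝ) : ℂ) * φ S
        + ∑ u ∈ Finset.univ.erase v, (((f (cnt (inc n v) S) - μ) * xiv v u S : ℝ) : ℂ) *
          (((fd f (dg' v u S) : ℝ) : ℂ) * φ S) := by
    funext S
    unfold Rv
    push_cast
    rw [mul_add, add_mul, Finset.mul_sum, Finset.sum_mul]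
    congr 1
    refine Finset.sum_congr rfl fun u _ => ?_
    ring
  have hterm : ∀ u ∈ Finset.univ.erase v,
      Ex p (fun S => (((f (cnt (inc n v) S) - μ) * xiv v u S : ℝ) : ℂ) *
          (((fd f (dg' v u S) : ℝ) : ℂ) * φ S))
      = ((p * (1 - p) * δ : ℝ) : ℂ) * Ex p (fun S => ((fd f (dg' v u S) : ℝ) : ℂ) * φ S) := by
    intro u hu
    rw [Ex_mul_of_indep p hdisj, Ex_ofReal, Ex_Z_xiv (by omega) p f v u (Finset.ne_of_mem_erase hu)]
    · intro x y hxy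
      have e1 := cnt_dep (inc n v) f hxy
      have e2 := xiv_dep v u hxy
      simp only at e1
      simp only [e1, e2]
    · intro x y hxy
      have e1 := dg'_dep v u (fd f) hxy
      have e2 := hφd hxy
      simp only at e1
      simp only [e1, e2]
  have hlast : Ex p (fun S => ((∑ u ∈ Finset.univ.erase v,
            (fd f (dg' v u S) - δ) : ℝ) : ℂ) * φ S)
      = ∑ u ∈ Finset.univ.erase v, Ex p (fun S => ((fd f (dg' v u S) : ℝ) : ℂ) * φ S)
        - (((n : ℝ) - 1) * δ : ℝ) * Ex p φ := by
    rw [← Ex_mul_left, ← Ex_sum, ← Ex_sub]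
    congr 1
    funext S
    rw [Finset.sum_sub_distrib, Finset.sum_const, Finset.card_erase_of_mem (Finset.mem_univ v),
      Finset.card_univ, Fintype.card_fin, nsmul_eq_mul, Nat.cast_pred (by omega)]
    push_cast
    rw [sub_mul, Finset.sum_mul]
  rw [hpt, Ex_add, Ex_sum, Finset.sum_congr rfl hterm, ← Finset.mul_sum, hlast,
    Ex_mul_of_indep p hdisj _ hφd, Ex_ofReal, Ex_Z_f]
  · unfold sigN
    push_cast
    ring
  · exact cnt_dep (inc n v) fun k => (((f k - μ) * f k : ℝ) : ℂ)

lemma abs_sigN_le {n : ℕ} (hn : 3 ≤ n) {p B L : ℝ} (h0 : 0 ≤ p) (h1 : p ≤ 1)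
    (hL : n * p ≤ L) {f : ℕ → ℝ} (hf : ∀ k, |f k| ≤ B) :
    |sigN n p f| ≤ B ^ 2 * (2 + 4 * L) := by
  have hB : 0 ≤ B := (abs_nonneg _).trans (hf 0)
  have hn' : (3 : ℝ) ≤ n := by exact_mod_cast hn
  have a1 : |Bn p (n - 1) (fun k => f k ^ 2)| ≤ B ^ 2 := abs_Bn_le_const h0 h1 _ fun k => by
    rw [abs_pow]; exact pow_le_pow_left₀ (abs_nonneg _) (hf k) 2
  have a2 : |Bn p (n - 1) f ^ 2| ≤ B ^ 2 := by
    rw [abs_pow]; exact pow_le_pow_left₀ (abs_nonneg _) (abs_Bn_le_const h0 h1 _ hf) 2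
  have a3 : |Bn p (n - 2) (fd f) ^ 2| ≤ (2 * B) ^ 2 := by
    rw [abs_pow]
    exact pow_le_pow_left₀ (abs_nonneg _) (abs_Bn_le_const h0 h1 _ (abs_fd_le hf)) 2
  have hc0 : 0 ≤ ((n : ℝ) - 1) * (p * (1 - p)) :=
    mul_nonneg (by linarith) (mul_nonneg h0 (by linarith))
  have hc : ((n : ℝ) - 1) * (p * (1 - p)) ≤ L := by
    refine le_trans ?_ hL
    have : p * (1 - p) ≤ p := by nlinarith
    exact mul_le_mul (by linarith) this (mul_nonneg h0 (by linarith)) (by linarith)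
  unfold sigN
  have h3 : |((n : ℝ) - 1) * (p * (1 - p)) * Bn p (n - 2) (fd f) ^ 2| ≤ L * (2 * B) ^ 2 := by
    rw [abs_mul, abs_of_nonneg hc0]
    exact mul_le_mul hc a3 (abs_nonneg _) (hc0.trans hc)
  calc _ ≤ _ := abs_add_le _ _
    _ ≤ (B ^ 2 + B ^ 2) + L * (2 * B) ^ 2 := by
      gcongr
      exact (abs_sub _ _).trans (by gcongr)
    _ = _ := by ring

/-- Constant in the Stein step. -/
def stC (B L : ℝ) : ℝ :=
  24 * B ^ 3 * (1 + 3 * L + L ^ 2) + 4 * B ^ 2 * L * Real.sqrt (1 + 4 * L)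
    + B ^ 2 * (2 + 4 * L) * (2 * B * (1 + 3 * L + L ^ 2))

lemma stein_step {n : ℕ} (hn : 3 ≤ n) {p B L : ℝ} (h0 : 0 ≤ p) (h1 : p ≤ 1)
    (hL : n * p ≤ L) {f : ℕ → ℝ} (hf : ∀ k, |f k| ≤ B) (v : Fin n) (t : ℝ) :
    ‖Ex p (fun S => ((f (cnt (inc n v) S) - Bn p (n - 1) f : ℝ) : ℂ) * eit (t * Xn n p f S))
      - Complex.I * (t * (Real.sqrt n)⁻¹ : ℝ) * (sigN n p f : ℂ) *
        Ex p (fun S => eit (t * Xn n p f S))‖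
      ≤ stC B L * (|t| + t ^ 2) * ((Real.sqrt n)⁻¹) ^ 2 := by
  have hB : 0 ≤ B := (abs_nonneg _).trans (hf 0)
  have hn' : (3 : ℝ) ≤ n := by exact_mod_cast hn
  have hL0 : 0 ≤ L := le_trans (by positivity) hL
  set s := (Real.sqrt n)⁻¹ with hs
  have hs0 : 0 ≤ s := by positivity
  set μ := Bn p (n - 1) f with hμ
  set δ := Bn p (n - 2) (fd f) with hδ
  set Z : (EdgeIdx n → Bool) → ℝ := fun S => f (cnt (inc n v) S) - μ with hZ
  set φ : (EdgeIdx n → Bool) → ℂ := fun S => eit (t * Xp n p f v S) with hφ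
  set M := 1 + 3 * L + L ^ 2 with hM
  have hM0 : 0 ≤ M := by positivity
  have hZb : ∀ S, |Z S| ≤ 2 * B := fun S =>
    (abs_sub _ _).trans (by linarith [hf (cnt (inc n v) S), abs_Bn_le_const h0 h1 (n - 1) hf])
  have hDM : Ex p (fun S => (1 + (cnt (inc n v) S : ℝ)) ^ 2) ≤ M := Ex_one_add_deg_sq h0 h1 hL v
  have hX : ∀ S, eit (t * Xn n p f S) = φ S * eit (t * s * Rv n f v S) := by
    intro S
    rw [hφ, ← eit_add, Xn_eq n p f v S]
    congr 1
    ring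
  -- first error
  have hE1 : ‖Ex p (fun S => (Z S : ℂ) * eit (t * Xn n p f S)) - Ex p (fun S => (Z S : ℂ) * φ S)
      - Complex.I * (t * s : ℝ) * Ex p (fun S => ((Z S * Rv n f v S : ℝ) : ℂ) * φ S)‖
      ≤ 24 * B ^ 3 * t ^ 2 * s ^ 2 * M := by
    rw [← Ex_mul_left, ← Ex_sub, ← Ex_sub]
    refine (norm_Ex_le h0 h1 _).trans ?_
    refine (Ex_mono h0 h1 (h := fun S => (24 * B ^ 3 * t ^ 2 * s ^ 2) *
      (1 + (cnt (inc n v) S : ℝ)) ^ 2) fun S => ?_).trans ?_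
    · have e : (Z S : ℂ) * eit (t * Xn n p f S) - (Z S : ℂ) * φ S
          - Complex.I * (t * s : ℝ) * (((Z S * Rv n f v S : ℝ) : ℂ) * φ S)
          = (Z S : ℂ) * φ S * (eit (t * s * Rv n f v S) - 1
            - Complex.I * (t * s * Rv n f v S : ℝ)) := by
        rw [hX]
        push_cast
        ring
      rw [e, norm_mul, norm_mul, norm_eit, mul_one, Complex.norm_real, Real.norm_eq_abs]
      have h3 := norm_eit_sub_one_sub (t * s * Rv n f v S)
      have h4 : Rv n f v S ^ 2 ≤ (2 * B * (1 + (cnt (inc n v) S : ℝ))) ^ 2 := by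
        rw [← sq_abs]
        exact pow_le_pow_left₀ (abs_nonneg _) (abs_Rv_le hf v S) 2
      calc _ ≤ (2 * B) * (3 * (t * s * Rv n f v S) ^ 2) :=
            mul_le_mul (hZb S) h3 (norm_nonneg _) (by positivity)
        _ = (6 * B * t ^ 2 * s ^ 2) * Rv n f v S ^ 2 := by ring
        _ ≤ (6 * B * t ^ 2 * s ^ 2) * (2 * B * (1 + (cnt (inc n v) S : ℝ))) ^ 2 := by gcongr
        _ = _ := by ring
    · rw [Ex_mul_left]
      gcongr
  have hdisj : Disjoint (inc n v) (inc n v)ᶜ := disjoint_compl_right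
  have hE2 : Ex p (fun S => (Z S : ℂ) * φ S) = 0 := by
    rw [Ex_mul_of_indep p hdisj (cnt_dep (inc n v) fun k => ((f k - μ : ℝ) : ℂ))
      (Xp_dep p f v (fun x => eit (t * x))), Ex_ofReal, Ex_Z]
    simp
  have hE3 := Ex_ZR hn p f v t
  rw [← hμ, ← hδ] at hE3
  set Y : (EdgeIdx n → Bool) → ℝ :=
    fun S => ∑ u ∈ Finset.univ.erase v, (fd f (dg' v u S) - δ) with hY
  have hE4 : ‖((p * (1 - p) * δ : ℝ) : ℂ) * Ex p (fun S => (Y S : ℂ) * φ S)‖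
      ≤ 4 * B ^ 2 * L * Real.sqrt (1 + 4 * L) * s := by
    rw [norm_mul, Complex.norm_real, Real.norm_eq_abs]
    have c1 : |p * (1 - p) * δ| ≤ p * (2 * B) := by
      rw [abs_mul, abs_of_nonneg (mul_nonneg h0 (by linarith : (0 : ℝ) ≤ 1 - p))]
      exact mul_le_mul (by nlinarith) (abs_Bn_le_const h0 h1 _ (abs_fd_le hf)) (abs_nonneg _) h0
    have c2 : ‖Ex p (fun S => (Y S : ℂ) * φ S)‖ ≤ Real.sqrt n * (2 * B * Real.sqrt (1 + 4 * L)) := by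
      refine (norm_Ex_le h0 h1 _).trans ?_
      have e : (fun S => ‖(Y S : ℂ) * φ S‖) = fun S => |Y S| := by
        funext S
        rw [norm_mul, norm_eit, mul_one, Complex.norm_real, Real.norm_eq_abs]
      rw [e]
      have h5 := Ex_sq_le h0 h1 (fun S => |Y S|)
      simp only [sq_abs] at h5
      have h6 := h5.trans (Ex_Y_sq hn h0 h1 hL hf v)
      refine abs_le_of_sq_le_sq' ?_ (by positivity) |>.2
      refine h6.trans (le_of_eq ?_)
      rw [mul_pow, mul_pow, Real.sq_sqrt (by positivity), Real.sq_sqrt (by positivity)]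
      ring
    calc _ ≤ (p * (2 * B)) * (Real.sqrt n * (2 * B * Real.sqrt (1 + 4 * L))) :=
          mul_le_mul c1 c2 (norm_nonneg _) (by positivity)
      _ = 4 * B ^ 2 * (n * p) * Real.sqrt (1 + 4 * L) * s := by
          have : Real.sqrt n = n * s := by
            rw [hs, ← div_eq_mul_inv, Real.div_sqrt]
          rw [this]; ring
      _ ≤ _ := by gcongr
  have hE5 : ‖Ex p φ - Ex p (fun S => eit (t * Xn n p f S))‖ ≤ |t| * s * (2 * B * M) := by
    rw [← Ex_sub]
    refine (norm_Ex_le h0 h1 _).trans ?_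
    refine (Ex_mono h0 h1 (h := fun S => (|t| * s * (2 * B)) *
      (1 + (cnt (inc n v) S : ℝ)) ^ 2) fun S => ?_).trans ?_
    · refine (norm_eit_sub _ _).trans ?_
      rw [Xn_eq n p f v S, ← hs]
      have e : t * Xp n p f v S - t * (Xp n p f v S + s * Rv n f v S) = - (t * s * Rv n f v S) := by
        ring
      rw [e, abs_neg, abs_mul, abs_mul, abs_of_nonneg hs0]
      have h7 := abs_Rv_le hf v S
      have h8 : (1 : ℝ) + cnt (inc n v) S ≤ (1 + (cnt (inc n v) S : ℝ)) ^ 2 := by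
        have : (0 : ℝ) ≤ cnt (inc n v) S := by positivity
        nlinarith
      calc |t| * s * |Rv n f v S| ≤ |t| * s * (2 * B * (1 + (cnt (inc n v) S : ℝ)) ^ 2) := by
            gcongr
            exact h7.trans (by gcongr)
        _ = _ := by ring
    · rw [Ex_mul_left]
      calc _ ≤ |t| * s * (2 * B) * M := by gcongr
        _ = _ := by ring
  have hsig := abs_sigN_le hn h0 h1 hL hf
  -- combine
  have hfin : Ex p (fun S => (Z S : ℂ) * eit (t * Xn n p f S))
      - Complex.I * (t * s : ℝ) * (sigN n p f : ℂ) * Ex p (fun S => eit (t * Xn n p f S))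
      = (Ex p (fun S => (Z S : ℂ) * eit (t * Xn n p f S)) - Ex p (fun S => (Z S : ℂ) * φ S)
      - Complex.I * (t * s : ℝ) * Ex p (fun S => ((Z S * Rv n f v S : ℝ) : ℂ) * φ S))
      + Complex.I * (t * s : ℝ) * ((((p * (1 - p) * δ : ℝ) : ℂ) * Ex p (fun S => (Y S : ℂ) * φ S))
        + (sigN n p f : ℂ) * (Ex p φ - Ex p (fun S => eit (t * Xn n p f S)))) := by
    rw [hE3, hE2]
    ring
  rw [hfin]
  refine (norm_add_le _ _).trans ?_
  have hI : ‖Complex.I * ((t * s : ℝ) : ℂ)‖ = |t| * s := by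
    rw [norm_mul, Complex.norm_I, one_mul, Complex.norm_real, Real.norm_eq_abs, abs_mul,
      abs_of_nonneg hs0]
  rw [norm_mul (Complex.I * ((t * s : ℝ) : ℂ)), hI]
  have hE6 : ‖(((p * (1 - p) * δ : ℝ) : ℂ) * Ex p (fun S => (Y S : ℂ) * φ S))
        + (sigN n p f : ℂ) * (Ex p φ - Ex p (fun S => eit (t * Xn n p f S)))‖
      ≤ 4 * B ^ 2 * L * Real.sqrt (1 + 4 * L) * s
        + B ^ 2 * (2 + 4 * L) * (|t| * s * (2 * B * M)) := by
    refine (norm_add_le _ _).trans (add_le_add hE4 ?_)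
    rw [norm_mul, Complex.norm_real, Real.norm_eq_abs]
    exact mul_le_mul hsig hE5 (norm_nonneg _) (by positivity)
  calc _ ≤ 24 * B ^ 3 * t ^ 2 * s ^ 2 * M + |t| * s * (4 * B ^ 2 * L * Real.sqrt (1 + 4 * L) * s
        + B ^ 2 * (2 + 4 * L) * (|t| * s * (2 * B * M))) := by gcongr
    _ = (24 * B ^ 3 * M * t ^ 2 + 4 * B ^ 2 * L * Real.sqrt (1 + 4 * L) * |t|
        + B ^ 2 * (2 + 4 * L) * (2 * B * M) * |t| ^ 2) * s ^ 2 := by ring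
    _ ≤ (24 * B ^ 3 * M * (|t| + t ^ 2) + 4 * B ^ 2 * L * Real.sqrt (1 + 4 * L) * (|t| + t ^ 2)
        + B ^ 2 * (2 + 4 * L) * (2 * B * M) * (|t| + t ^ 2)) * s ^ 2 := by
      rw [sq_abs]
      have t1 : t ^ 2 ≤ |t| + t ^ 2 := by linarith [abs_nonneg t]
      have t2 : |t| ≤ |t| + t ^ 2 := by linarith [sq_nonneg t]
      gcongr
    _ = stC B L * (|t| + t ^ 2) * s ^ 2 := by
      unfold stC
      rw [← hM]
      ring

end SteinStep

/-! ### Characteristic function of the normalized sum -/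

section CharODE

lemma Xn_eq_sum {n : ℕ} (p : ℝ) (f : ℕ → ℝ) (S : EdgeIdx n → Bool) :
    Xn n p f S = (Real.sqrt n)⁻¹ * ∑ v, (f (cnt (inc n v) S) - Bn p (n - 1) f) := by
  unfold Xn
  rw [Finset.sum_sub_distrib, Finset.sum_const, Finset.card_univ, Fintype.card_fin, nsmul_eq_mul]

lemma Ex_Xn_sq {n : ℕ} (hn : 3 ≤ n) (p : ℝ) (f : ℕ → ℝ) :
    Ex p (fun S => Xn n p f S ^ 2) = sigN n p f := by
  have hn' : (0 : ℝ) < n := by exact_mod_cast (by omega : 0 < n)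
  have h := Ex_sum_sq p Finset.univ (fun u => inc n u) (M := n - 2)
    (fun u _ => by rw [card_inc]; omega)
    (fun u _ w _ huw => by rw [inc_inter u w huw]; simp) f
  rw [show n - 2 + 1 = n - 1 by omega] at h
  simp only [Xn_eq_sum, mul_pow]
  rw [Ex_mul_left, h, Finset.card_univ, Fintype.card_fin, inv_pow, Real.sq_sqrt hn'.le]
  unfold sigN
  field_simp

lemma sigN_nonneg {n : ℕ} (hn : 3 ≤ n) {p : ℝ} (h0 : 0 ≤ p) (h1 : p ≤ 1) (f : ℕ → ℝ) :
    0 ≤ sigN n p f := by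
  rw [← Ex_Xn_sq hn]
  exact Ex_nonneg h0 h1 fun S => sq_nonneg _

lemma Ex_X_eit {n : ℕ} (hn : 3 ≤ n) {p B L : ℝ} (h0 : 0 ≤ p) (h1 : p ≤ 1)
    (hL : n * p ≤ L) {f : ℕ → ℝ} (hf : ∀ k, |f k| ≤ B) (t : ℝ) :
    ‖Ex p (fun S => (Xn n p f S : ℂ) * eit (t * Xn n p f S))
      - Complex.I * t * (sigN n p f : ℂ) * Ex p (fun S => eit (t * Xn n p f S))‖
      ≤ stC B L * (|t| + t ^ 2) * (Real.sqrt n)⁻¹ := by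
  have hn' : (0 : ℝ) < n := by exact_mod_cast (by omega : 0 < n)
  set s := (Real.sqrt n)⁻¹ with hs
  have hs0 : 0 ≤ s := by positivity
  have hns : (n : ℝ) * s ^ 2 = 1 := by
    rw [hs, inv_pow, Real.sq_sqrt hn'.le]
    exact mul_inv_cancel₀ hn'.ne'
  have e1 : (fun S => (Xn n p f S : ℂ) * eit (t * Xn n p f S))
      = fun S => (s : ℂ) * ∑ v, ((f (cnt (inc n v) S) - Bn p (n - 1) f : ℝ) : ℂ)
        * eit (t * Xn n p f S) := by
    funext S
    rw [← Finset.sum_mul, ← mul_assoc]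
    congr 1
    rw [Xn_eq_sum, ← hs]
    push_cast
    rfl
  have e2 : Ex p (fun S => (Xn n p f S : ℂ) * eit (t * Xn n p f S))
      - Complex.I * t * (sigN n p f : ℂ) * Ex p (fun S => eit (t * Xn n p f S))
      = (s : ℂ) * ∑ v, (Ex p (fun S => ((f (cnt (inc n v) S) - Bn p (n - 1) f : ℝ) : ℂ)
        * eit (t * Xn n p f S)) - Complex.I * (t * s : ℝ) * (sigN n p f : ℂ) *
        Ex p (fun S => eit (t * Xn n p f S))) := by
    rw [e1, Ex_mul_left, Ex_sum, Finset.sum_sub_distrib, Finset.sum_const, Finset.card_univ,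
      Fintype.card_fin, nsmul_eq_mul, mul_sub]
    congr 1
    have hns' : (n : ℂ) * (s : ℂ) ^ 2 = 1 := by exact_mod_cast hns
    push_cast
    linear_combination (-(Complex.I * t * (sigN n p f : ℂ) *
      Ex p (fun S => eit (t * Xn n p f S)))) * hns'
  rw [e2, norm_mul, Complex.norm_real, Real.norm_of_nonneg hs0]
  have h3 := norm_sum_le_of_le (Finset.univ : Finset (Fin n))
    (fun v _ => stein_step hn h0 h1 hL hf v t)
  rw [Finset.sum_const, Finset.card_univ, Fintype.card_fin, nsmul_eq_mul, ← hs] at h3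
  calc _ ≤ s * (n * (stC B L * (|t| + t ^ 2) * s ^ 2)) := by gcongr
    _ = stC B L * (|t| + t ^ 2) * s * (n * s ^ 2) := by ring
    _ = _ := by rw [hns, mul_one]

lemma hasDerivAt_Ex_eit {n : ℕ} (p : ℝ) (X : (EdgeIdx n → Bool) → ℝ) (t : ℝ) :
    HasDerivAt (fun t : ℝ => Ex p (fun S => eit (t * X S)))
      (Complex.I * Ex p (fun S => (X S : ℂ) * eit (t * X S))) t := by
  rw [← Ex_mul_left]
  unfold Ex
  refine HasDerivAt.fun_sum fun S _ => ?_
  refine HasDerivAt.const_smul _ ?_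
  unfold eit
  have h1 : HasDerivAt (fun t : ℝ => Complex.I * ((t * X S : ℝ) : ℂ)) (Complex.I * X S) t := by
    have h2 : HasDerivAt (fun t : ℝ => ((t * X S : ℝ) : ℂ)) ((X S : ℝ) : ℂ) t := by
      have := (hasDerivAt_id t).mul_const (X S)
      simp only [id, one_mul] at this
      exact this.ofReal_comp
    exact h2.const_mul _
  exact h1.cexp.congr_deriv (by ring)

lemma stC_nonneg {B L : ℝ} (hB : 0 ≤ B) (hL : 0 ≤ L) : 0 ≤ stC B L := by
  unfold stC
  positivity

lemma char_bound {n : ℕ} (hn : 3 ≤ n) {p B L : ℝ} (h0 : 0 ≤ p) (h1 : p ≤ 1)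
    (hL : n * p ≤ L) {f : ℕ → ℝ} (hf : ∀ k, |f k| ≤ B) (τ : ℝ) :
    ‖Ex p (fun S => eit (τ * Xn n p f S)) - ((Real.exp (-(sigN n p f * τ ^ 2 / 2)) : ℝ) : ℂ)‖
      ≤ stC B L * (|τ| + τ ^ 2) * Real.exp (B ^ 2 * (2 + 4 * L) * τ ^ 2 / 2) * |τ|
        * (Real.sqrt n)⁻¹ := by
  have hB : 0 ≤ B := (abs_nonneg _).trans (hf 0)
  have hL0 : 0 ≤ L := le_trans (by positivity) hL
  set v := sigN n p f with hv
  have hv0 : 0 ≤ v := sigN_nonneg hn h0 h1 f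
  have hvb : v ≤ B ^ 2 * (2 + 4 * L) := (le_abs_self _).trans (abs_sigN_le hn h0 h1 hL hf)
  set s := (Real.sqrt n)⁻¹ with hs
  have hs0 : 0 ≤ s := by positivity
  have hC := stC_nonneg hB hL0
  let φ : ℝ → ℂ := fun t => Ex p (fun S => eit (t * Xn n p f S))
  let ψ : ℝ → ℂ := fun t => φ t * ((Real.exp (v * t ^ 2 / 2) : ℝ) : ℂ)
  have hg : ∀ t : ℝ, HasDerivAt (fun t : ℝ => ((Real.exp (v * t ^ 2 / 2) : ℝ) : ℂ))
      ((Real.exp (v * t ^ 2 / 2) * (v * t) : ℝ) : ℂ) t := by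
    intro t
    have h2 : HasDerivAt (fun t : ℝ => v * t ^ 2 / 2) (v * t) t := by
      have := ((hasDerivAt_pow 2 t).const_mul v).div_const 2
      exact this.congr_deriv (by push_cast; ring)
    exact h2.exp.ofReal_comp
  have hψ : ∀ t, HasDerivAt ψ (Complex.I * Ex p (fun S => (Xn n p f S : ℂ) * eit (t * Xn n p f S))
      * ((Real.exp (v * t ^ 2 / 2) : ℝ) : ℂ) + φ t * ((Real.exp (v * t ^ 2 / 2) * (v * t) : ℝ) : ℂ)) t :=
    fun t => (hasDerivAt_Ex_eit p (Xn n p f) t).mul (hg t)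
  have hbound : ∀ t ∈ Set.Icc (-|τ|) |τ|,
      ‖Complex.I * Ex p (fun S => (Xn n p f S : ℂ) * eit (t * Xn n p f S))
      * ((Real.exp (v * t ^ 2 / 2) : ℝ) : ℂ) + φ t * ((Real.exp (v * t ^ 2 / 2) * (v * t) : ℝ) : ℂ)‖
      ≤ stC B L * (|τ| + τ ^ 2) * s * Real.exp (B ^ 2 * (2 + 4 * L) * τ ^ 2 / 2) := by
    intro t ht
    have ht1 : |t| ≤ |τ| := abs_le.2 ht
    have ht2 : t ^ 2 ≤ τ ^ 2 := sq_le_sq.2 ht1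
    have e : Complex.I * Ex p (fun S => (Xn n p f S : ℂ) * eit (t * Xn n p f S))
      * ((Real.exp (v * t ^ 2 / 2) : ℝ) : ℂ) + φ t * ((Real.exp (v * t ^ 2 / 2) * (v * t) : ℝ) : ℂ)
      = Complex.I * (Ex p (fun S => (Xn n p f S : ℂ) * eit (t * Xn n p f S))
      - Complex.I * t * (v : ℂ) * φ t) * ((Real.exp (v * t ^ 2 / 2) : ℝ) : ℂ) := by
      push_cast
      linear_combination (t * v * φ t * Complex.exp (v * t ^ 2 / 2)) * Complex.I_sq
    rw [e, norm_mul, norm_mul, Complex.norm_I, one_mul, Complex.norm_real,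
      Real.norm_of_nonneg (Real.exp_pos _).le]
    refine mul_le_mul ((Ex_X_eit hn h0 h1 hL hf t).trans ?_) ?_ (Real.exp_pos _).le (by positivity)
    · rw [← hs]
      gcongr
    · apply Real.exp_le_exp.2
      gcongr
  have hmv := Convex.norm_image_sub_le_of_norm_hasDerivWithin_le (f := ψ)
    (fun t ht => (hψ t).hasDerivWithinAt) hbound (convex_Icc _ _)
    (x := 0) (y := τ) (by simp) ⟨neg_abs_le τ, le_abs_self τ⟩
  have hψ0 : ψ 0 = 1 := by
    simp only [ψ, φ]
    have : (fun S => eit (0 * Xn n p f S)) = fun _ => (1 : ℂ) := by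
      funext S; simp [eit]
    rw [this, Ex_const]
    simp
  rw [hψ0, sub_zero, Real.norm_eq_abs] at hmv
  have e2 : φ τ - ((Real.exp (-(v * τ ^ 2 / 2)) : ℝ) : ℂ)
      = (ψ τ - 1) * ((Real.exp (-(v * τ ^ 2 / 2)) : ℝ) : ℂ) := by
    have : Real.exp (v * τ ^ 2 / 2) * Real.exp (-(v * τ ^ 2 / 2)) = 1 := by
      rw [← Real.exp_add]; simp
    have h' : ((Real.exp (v * τ ^ 2 / 2) : ℝ) : ℂ) * ((Real.exp (-(v * τ ^ 2 / 2)) : ℝ) : ℂ) = 1 := by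
      exact_mod_cast this
    simp only [ψ]
    linear_combination (-(φ τ)) * h'
  change ‖φ τ - _‖ ≤ _
  rw [e2, norm_mul, Complex.norm_real, Real.norm_of_nonneg (Real.exp_pos _).le]
  have h5 : Real.exp (-(v * τ ^ 2 / 2)) ≤ 1 := by
    apply Real.exp_le_one_iff.2
    have : 0 ≤ v * τ ^ 2 / 2 := by positivity
    linarith
  calc _ ≤ ‖ψ τ - 1‖ * 1 := by gcongr
    _ ≤ _ := by
      rw [mul_one]
      refine hmv.trans (le_of_eq ?_)
      ring

lemma char_tendsto_bdd {lamn : ℕ → ℝ} {L : ℝ}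
    (hev : ∀ᶠ n : ℕ in atTop, 3 ≤ n ∧ 0 ≤ lamn n / n ∧ lamn n / n ≤ 1 ∧ n * (lamn n / n) ≤ L)
    {f : ℕ → ℝ} {B : ℝ} (hf : ∀ k, |f k| ≤ B) {σ : ℝ}
    (hσ : Tendsto (fun n : ℕ => sigN n (lamn n / n) f) atTop (𝓝 σ)) (τ : ℝ) :
    Tendsto (fun n : ℕ => Ex (lamn n / n) (fun S => eit (τ * Xn n (lamn n / n) f S))) atTop
      (𝓝 ((Real.exp (-(σ * τ ^ 2 / 2)) : ℝ) : ℂ)) := by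
  have h1 : Tendsto (fun n : ℕ => ((Real.exp (-(sigN n (lamn n / n) f * τ ^ 2 / 2)) : ℝ) : ℂ)) atTop
      (𝓝 ((Real.exp (-(σ * τ ^ 2 / 2)) : ℝ) : ℂ)) := by
    refine (Complex.continuous_ofReal.tendsto _).comp ((Real.continuous_exp.tendsto _).comp ?_)
    exact ((hσ.mul_const _).div_const _).neg
  have h2 : Tendsto (fun n : ℕ => Ex (lamn n / n) (fun S => eit (τ * Xn n (lamn n / n) f S))
      - ((Real.exp (-(sigN n (lamn n / n) f * τ ^ 2 / 2)) : ℝ) : ℂ)) atTop (𝓝 0) := by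
    have hs : Tendsto (fun n : ℕ => stC B L * (|τ| + τ ^ 2) *
        Real.exp (B ^ 2 * (2 + 4 * L) * τ ^ 2 / 2) * |τ| * (Real.sqrt n)⁻¹) atTop (𝓝 0) := by
      have : Tendsto (fun n : ℕ => (Real.sqrt n)⁻¹) atTop (𝓝 0) :=
        tendsto_inv_atTop_zero.comp (Real.tendsto_sqrt_atTop.comp tendsto_natCast_atTop_atTop)
      simpa using this.const_mul (stC B L * (|τ| + τ ^ 2) *
        Real.exp (B ^ 2 * (2 + 4 * L) * τ ^ 2 / 2) * |τ|)
    refine squeeze_zero_norm' ?_ hs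
    filter_upwards [hev] with n hn
    exact char_bound hn.1 hn.2.1 hn.2.2.1 hn.2.2.2 hf τ
  simpa using h2.add h1

end CharODE

/-! ### Binomial to Poisson -/

section Poisson

lemma abs_pow_sub_pow_le_one {a b : ℝ} (ha0 : 0 ≤ a) (ha : a ≤ 1) (hb0 : 0 ≤ b) (hb : b ≤ 1)
    (j : ℕ) : |a ^ j - b ^ j| ≤ j * |a - b| := by
  induction j with
  | zero => simp
  | succ j ih =>
    have e : a ^ (j + 1) - b ^ (j + 1) = a * (a ^ j - b ^ j) + (a - b) * b ^ j := by ring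
    rw [e]
    have h1 : |a * (a ^ j - b ^ j)| ≤ 1 * (j * |a - b|) := by
      rw [abs_mul, abs_of_nonneg ha0]
      gcongr
    have h2 : |(a - b) * b ^ j| ≤ |a - b| * 1 := by
      rw [abs_mul, abs_of_nonneg (pow_nonneg hb0 j)]
      gcongr
      exact pow_le_one₀ hb0 hb
    have := abs_add_le (a * (a ^ j - b ^ j)) ((a - b) * b ^ j)
    push_cast
    nlinarith

lemma pow_sub_exp_bound {p : ℝ} (h0 : 0 ≤ p) (h1 : p ≤ 1) (j n : ℕ) (hjn : j ≤ n) :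
    |(1 - p) ^ j - Real.exp (-(n * p))| ≤ j * p ^ 2 + (n - j) * p := by
  have hz : Real.exp (-p) ^ j = Real.exp (-(j * p)) := by
    rw [← Real.exp_nat_mul]; ring_nf
  have hp1 : Real.exp (-p) ≤ 1 := Real.exp_le_one_iff.2 (by linarith)
  have a1 : |(1 - p) ^ j - Real.exp (-p) ^ j| ≤ j * p ^ 2 := by
    refine (abs_pow_sub_pow_le_one (by linarith) (by linarith) (Real.exp_pos _).le hp1 j).trans ?_
    gcongr
    have := Real.abs_exp_sub_one_sub_id_le (x := -p) (by rw [abs_neg, abs_of_nonneg h0]; exact h1)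
    rw [abs_sub_comm]
    calc _ = |Real.exp (-p) - 1 - -p| := by congr 1; ring
      _ ≤ (-p) ^ 2 := this
      _ = p ^ 2 := by ring
  have a2 : |Real.exp (-(j * p)) - Real.exp (-(n * p))| ≤ (n - j) * p := by
    have hj : (j : ℝ) ≤ n := by exact_mod_cast hjn
    have e : Real.exp (-(n * p)) = Real.exp (-(j * p)) * Real.exp (-((n - j) * p)) := by
      rw [← Real.exp_add]; ring_nf
    have hd : 0 ≤ ((n : ℝ) - j) * p := mul_nonneg (by linarith) h0
    have h3 : 1 - ((n : ℝ) - j) * p ≤ Real.exp (-((n - j) * p)) := by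
      have := Real.add_one_le_exp (-(((n : ℝ) - j) * p)); linarith
    have h4 : Real.exp (-(((n : ℝ) - j) * p)) ≤ 1 := Real.exp_le_one_iff.2 (by linarith)
    have h5 : Real.exp (-(j * p)) ≤ 1 := Real.exp_le_one_iff.2 (by
      have : 0 ≤ (j : ℝ) * p := by positivity
      linarith)
    have h6 := Real.exp_pos (-(j * p))
    rw [e, abs_le]
    constructor <;> nlinarith
  rw [hz] at a1
  exact (abs_sub_le _ _ _).trans (add_le_add a1 a2)

lemma bpmf_poisson {n m : ℕ} (hn : 1 ≤ n) (hm : m ≤ n) (hm2 : n ≤ m + 2) {p L : ℝ}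
    (h0 : 0 ≤ p) (h1 : p ≤ 1) (hL : n * p ≤ L) (k : ℕ) :
    |bpmf p m k - poissonProb (n * p) k|
      ≤ (1 + L) ^ 2 * ((k + 1) ^ 2 * (L ^ k / (k.factorial : ℝ))) * (n : ℝ)⁻¹ := by
  have hn0 : (0 : ℝ) < n := by exact_mod_cast hn
  have hL0 : 0 ≤ L := le_trans (by positivity) hL
  set x : ℝ := (m.descFactorial k : ℝ) / n ^ k with hx
  set y : ℝ := (1 - p) ^ (m - k) with hy
  set z : ℝ := Real.exp (-(n * p)) with hz
  have hf : (0 : ℝ) < (k.factorial : ℝ) := by exact_mod_cast k.factorial_pos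
  have e : bpmf p m k - poissonProb (n * p) k = (n * p) ^ k / k.factorial * (x * y - z) := by
    unfold bpmf poissonProb
    rw [hx, Nat.descFactorial_eq_factorial_mul_choose]
    push_cast
    rw [← hz, ← hy, mul_pow]
    field_simp
  have hy0 : 0 ≤ y := pow_nonneg (by linarith) _
  have hy1 : y ≤ 1 := pow_le_one₀ (by linarith) (by linarith)
  have hz0 : 0 ≤ z := (Real.exp_pos _).le
  have hz1 : z ≤ 1 := Real.exp_le_one_iff.2 (by
    have : 0 ≤ (n : ℝ) * p := by positivity
    linarith)
  have key : |x * y - z| ≤ (1 + L) ^ 2 * (k + 1) ^ 2 * (n : ℝ)⁻¹ := by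
    rw [← div_eq_mul_inv]
    rcases lt_or_ge m k with hk | hk
    · have hx0 : x = 0 := by
        rw [hx, Nat.descFactorial_of_lt hk]; simp
      rw [hx0, zero_mul, zero_sub, abs_neg, abs_of_nonneg hz0]
      refine hz1.trans ?_
      rw [le_div_iff₀ hn0, one_mul]
      have : (n : ℝ) ≤ k + 1 := by exact_mod_cast (by omega : n ≤ k + 1)
      have h2 : (1 : ℝ) ≤ k + 1 := by linarith [Nat.cast_nonneg (α := ℝ) k]
      nlinarith [sq_nonneg L, mul_nonneg hL0 (sq_nonneg ((k : ℝ) + 1)), mul_nonneg (sq_nonneg L) (sq_nonneg ((k : ℝ) + 1))]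
    · have hx1 : x ≤ 1 := by
        rw [hx, div_le_one (by positivity)]
        have h2 := Nat.descFactorial_le_pow m k
        have h3 : m ^ k ≤ n ^ k := Nat.pow_le_pow_left hm k
        exact_mod_cast h2.trans h3
      have hx2 : 1 - k * (k + 1) / n ≤ x := by
        have h2 := Nat.pow_sub_le_descFactorial m k
        have h2' : ((m + 1 - k : ℕ) : ℝ) ^ k ≤ (m.descFactorial k : ℝ) := by exact_mod_cast h2
        set t : ℝ := ((m + 1 - k : ℕ) : ℝ) / n with ht
        have ht0 : 0 ≤ t := by positivity
        have h3 : t ^ k ≤ x := by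
          rw [ht, hx, div_pow]
          gcongr
        have h4 := one_add_mul_sub_le_pow (a := t) (by linarith) k
        have h5 : 1 - (k + 1) / n ≤ t := by
          rw [ht, Nat.cast_sub (by omega), ← sub_nonneg]
          have : (n : ℝ) ≤ m + 2 := by exact_mod_cast hm2
          have e2 : ((m + 1 : ℕ) - k : ℝ) / n - (1 - (k + 1) / n) = (m + 2 - n) / n := by
            push_cast
            field_simp
            ring
          rw [e2]
          exact div_nonneg (by linarith) hn0.le
        have h6 : (k : ℝ) * (-((k + 1) / n)) ≤ k * (t - 1) := by
          apply mul_le_mul_of_nonneg_left _ (Nat.cast_nonneg k)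
          linarith
        calc 1 - k * (k + 1) / n = 1 + (k : ℝ) * (-((k + 1) / n)) := by ring
          _ ≤ x := by linarith
      have hyz := pow_sub_exp_bound h0 h1 (m - k) n (by omega)
      rw [← hy, ← hz] at hyz
      have hj1 : ((m - k : ℕ) : ℝ) ≤ n := by exact_mod_cast (by omega : m - k ≤ n)
      have hj2 : (n : ℝ) - ((m - k : ℕ) : ℝ) ≤ k + 2 := by
        have : (n : ℝ) ≤ ((m - k : ℕ) : ℝ) + (k + 2) := by
          exact_mod_cast (by omega : n ≤ (m - k) + (k + 2))
        linarith
      have hpn : p ≤ L / n := by rw [le_div_iff₀ hn0]; linarith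
      have b1 : ((m - k : ℕ) : ℝ) * p ^ 2 ≤ L ^ 2 / n := by
        calc ((m - k : ℕ) : ℝ) * p ^ 2 ≤ n * (L / n) ^ 2 := by gcongr
          _ = _ := by field_simp
      have b2 : ((n : ℝ) - ((m - k : ℕ) : ℝ)) * p ≤ (k + 2) * (L / n) := by gcongr
      have b3 : |x * y - z| ≤ (1 - x) + |y - z| := by
        have e3 : x * y - z = -((1 - x) * y) + (y - z) := by ring
        rw [e3]
        refine (abs_add_le _ _).trans ?_
        gcongr
        rw [abs_neg, abs_mul, abs_of_nonneg (by linarith : 0 ≤ 1 - x), abs_of_nonneg hy0]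
        exact mul_le_of_le_one_right (by linarith) hy1
      calc |x * y - z| ≤ k * (k + 1) / n + (L ^ 2 / n + (k + 2) * (L / n)) := by linarith
        _ = (k * (k + 1) + L ^ 2 + (k + 2) * L) / n := by ring
        _ ≤ _ := by
          gcongr
          have hk0 : (0 : ℝ) ≤ k := Nat.cast_nonneg k
          nlinarith [mul_nonneg hL0 hk0, mul_nonneg (mul_nonneg hL0 hk0) hk0,
            mul_nonneg (sq_nonneg L) hk0, mul_nonneg (sq_nonneg L) (sq_nonneg (k : ℝ))]
  rw [e, abs_mul, abs_of_nonneg (by positivity)]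
  calc (n * p) ^ k / k.factorial * |x * y - z|
      ≤ L ^ k / k.factorial * ((1 + L) ^ 2 * (k + 1) ^ 2 * (n : ℝ)⁻¹) := by gcongr
    _ = _ := by ring

/-- Exponential growth. -/
def Gr (C A : ℝ) (g : ℕ → ℝ) : Prop := 0 ≤ C ∧ 1 ≤ A ∧ ∀ k, |g k| ≤ C * A ^ k

lemma Gr.mono {C A : ℝ} {g h : ℕ → ℝ} (hg : Gr C A g) (H : ∀ k, |h k| ≤ |g k|) : Gr C A h :=
  ⟨hg.1, hg.2.1, fun k => (H k).trans (hg.2.2 k)⟩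

lemma Gr.mul {C A C' A' : ℝ} {g h : ℕ → ℝ} (hg : Gr C A g) (hh : Gr C' A' h) :
    Gr (C * C') (A * A') (fun k => g k * h k) := by
  obtain ⟨a, b, c⟩ := hg
  obtain ⟨a', b', c'⟩ := hh
  refine ⟨by positivity, by nlinarith, fun k => ?_⟩
  rw [abs_mul, mul_pow]
  calc |g k| * |h k| ≤ (C * A ^ k) * (C' * A' ^ k) := by
        gcongr
        exacts [c k, c' k]
    _ = _ := by ring

lemma Gr.fd {C A : ℝ} {g : ℕ → ℝ} (hg : Gr C A g) : Gr (C * (A + 1)) A (fd g) := by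
  obtain ⟨a, b, c⟩ := hg
  refine ⟨by positivity, b, fun k => ?_⟩
  have h1 := c (k + 1)
  have h2 := c k
  have h3 := abs_sub (g (k + 1)) (g k)
  unfold _root_.fd
  calc _ ≤ C * A ^ (k + 1) + C * A ^ k := by linarith
    _ = _ := by ring

lemma Gr.shift {C A : ℝ} {g : ℕ → ℝ} (hg : Gr C A g) : Gr (C * A) A (fun k => g (k + 1)) := by
  obtain ⟨a, b, c⟩ := hg
  refine ⟨by positivity, b, fun k => (c (k + 1)).trans (le_of_eq (by ring))⟩

lemma Gr_id : Gr 1 2 (fun k => (k : ℝ)) := by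
  refine ⟨zero_le_one, one_le_two, fun k => ?_⟩
  change |(k : ℝ)| ≤ 1 * 2 ^ k
  rw [abs_of_nonneg (Nat.cast_nonneg k), one_mul]
  exact_mod_cast (Nat.lt_two_pow_self (n := k)).le

lemma Gr_one : Gr 1 1 (fun _ => (1 : ℝ)) := ⟨zero_le_one, le_rfl, fun k => by simp⟩

lemma summable_dom (L A C : ℝ) : Summable fun k : ℕ => L ^ k / (k.factorial : ℝ) * (C * A ^ k) := by
  have := (Real.summable_pow_div_factorial (L * A)).mul_left C
  refine this.congr fun k => ?_
  rw [mul_pow]; ring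

lemma summable_dom2 {L A C : ℝ} (hL : 0 ≤ L) (hA : 0 ≤ A) (hC : 0 ≤ C) :
    Summable fun k : ℕ => ((k : ℝ) + 1) ^ 2 * (L ^ k / (k.factorial : ℝ)) * (C * A ^ k) := by
  refine Summable.of_nonneg_of_le (fun k => by positivity) (fun k => ?_)
    (summable_dom L (4 * A) C)
  have h : ((k : ℝ) + 1) ^ 2 ≤ 4 ^ k := by
    have h1 : k + 1 ≤ 2 ^ k := Nat.lt_two_pow_self
    have h2 : (k + 1 : ℝ) ≤ 2 ^ k := by exact_mod_cast h1
    calc ((k : ℝ) + 1) ^ 2 ≤ (2 ^ k) ^ 2 := by gcongr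
      _ = 4 ^ k := by rw [← pow_mul, mul_comm, pow_mul]; norm_num
  calc _ ≤ 4 ^ k * (L ^ k / (k.factorial : ℝ)) * (C * A ^ k) := by gcongr
    _ = _ := by rw [mul_pow]; ring

lemma poissonProb_nonneg {μ : ℝ} (h : 0 ≤ μ) (k : ℕ) : 0 ≤ poissonProb μ k := by
  unfold poissonProb
  positivity

lemma poissonProb_le {μ L : ℝ} (h : 0 ≤ μ) (hL : μ ≤ L) (k : ℕ) :
    poissonProb μ k ≤ L ^ k / (k.factorial : ℝ) := by
  unfold poissonProb
  have : Real.exp (-μ) ≤ 1 := Real.exp_le_one_iff.2 (by linarith)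
  gcongr
  calc Real.exp (-μ) * μ ^ k ≤ 1 * L ^ k := by gcongr
    _ = _ := one_mul _

/-- Poisson expectation. -/
def Pe (μ : ℝ) (g : ℕ → ℝ) : ℝ := ∑' k, poissonProb μ k * g k

lemma norm_Pe_term {μ L : ℝ} (h : 0 ≤ μ) (hL : μ ≤ L) {C A : ℝ} {g : ℕ → ℝ} (hg : Gr C A g)
    (k : ℕ) : ‖poissonProb μ k * g k‖ ≤ L ^ k / (k.factorial : ℝ) * (C * A ^ k) := by
  have hL0 := h.trans hL
  rw [norm_mul, Real.norm_of_nonneg (poissonProb_nonneg h k), Real.norm_eq_abs]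
  have := hg.2.2 k
  have := poissonProb_le h hL k
  gcongr

lemma summable_Pe {μ : ℝ} (h : 0 ≤ μ) {C A : ℝ} {g : ℕ → ℝ} (hg : Gr C A g) :
    Summable fun k => poissonProb μ k * g k :=
  Summable.of_norm_bounded (summable_dom μ A C) (norm_Pe_term h le_rfl hg)

lemma Bn_sub_Pe {n m : ℕ} (hn : 1 ≤ n) (hm : m ≤ n) (hm2 : n ≤ m + 2) {p L : ℝ}
    (h0 : 0 ≤ p) (h1 : p ≤ 1) (hL : n * p ≤ L) {C A : ℝ} {g : ℕ → ℝ} (hg : Gr C A g) :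
    |Bn p m g - Pe (n * p) g| ≤
      (∑' k : ℕ, ((k : ℝ) + 1) ^ 2 * (L ^ k / (k.factorial : ℝ)) * (C * A ^ k))
        * ((1 + L) ^ 2 * (n : ℝ)⁻¹) := by
  have hμ : (0 : ℝ) ≤ n * p := by positivity
  have hL0 := hμ.trans hL
  have hz : ∀ k ∉ Finset.range (m + 1), bpmf p m k * g k = 0 := by
    intro k hk
    rw [Finset.mem_range, not_lt] at hk
    unfold bpmf
    rw [Nat.choose_eq_zero_of_lt (by omega)]
    simp
  have hB : Bn p m g = ∑' k, bpmf p m k * g k := by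
    rw [Bn_eq_sum p m (m + 1) (Nat.lt_succ_self m), tsum_eq_sum hz]
  have hs : Summable fun k => bpmf p m k * g k := summable_of_ne_finset_zero hz
  have hP := summable_Pe hμ hg
  rw [hB, Pe, ← hs.tsum_sub hP, ← Real.norm_eq_abs, ← tsum_mul_right]
  refine tsum_of_norm_bounded
    ((summable_dom2 hL0 (zero_le_one.trans hg.2.1) hg.1).mul_right _).hasSum fun k => ?_
  rw [← sub_mul, norm_mul, Real.norm_eq_abs, Real.norm_eq_abs]
  have a := bpmf_poisson hn hm hm2 h0 h1 hL k
  have b := hg.2.2 k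
  calc _ ≤ ((1 + L) ^ 2 * ((k + 1) ^ 2 * (L ^ k / (k.factorial : ℝ))) * (n : ℝ)⁻¹) * (C * A ^ k) := by
        gcongr
    _ = _ := by ring

lemma Pe_tendsto {lamn : ℕ → ℝ} {lam : ℝ} (hlam : 0 < lam) (hconv : Tendsto lamn atTop (𝓝 lam))
    {C A : ℝ} {g : ℕ → ℝ} (hg : Gr C A g) :
    Tendsto (fun n => Pe (lamn n) g) atTop (𝓝 (Pe lam g)) := by
  unfold Pe
  refine tendsto_tsum_of_dominated_convergence (summable_dom (lam + 1) A C) (fun k => ?_) ?_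
  · have hc : Continuous fun μ : ℝ => poissonProb μ k * g k := by
      unfold poissonProb
      fun_prop
    exact (hc.tendsto lam).comp hconv
  · filter_upwards [hconv.eventually (lt_mem_nhds hlam),
      hconv.eventually (gt_mem_nhds (lt_add_one lam))] with n h1 h2 k
    exact norm_Pe_term h1.le h2.le hg k

end Poisson

/-! ### Limiting variance -/

section LimitVar

/-- The range of parameters eventually satisfied. -/
def Ev (lamn : ℕ → ℝ) (L : ℝ) : Prop :=
  ∀ᶠ n : ℕ in atTop, 3 ≤ n ∧ 0 ≤ lamn n / n ∧ lamn n / n ≤ 1 ∧ n * (lamn n / n) ≤ L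

lemma ev_of_tendsto {lamn : ℕ → ℝ} {lam : ℝ} (hlam : 0 < lam)
    (hconv : Tendsto lamn atTop (𝓝 lam)) : Ev lamn (lam + 1) := by
  filter_upwards [hconv.eventually (lt_mem_nhds hlam),
      hconv.eventually (gt_mem_nhds (lt_add_one lam)), eventually_ge_atTop 3,
      eventually_ge_atTop ⌈lam + 1⌉₊] with n h1 h2 h3 h4
  have hn : (0 : ℝ) < n := by exact_mod_cast (by omega : 0 < n)
  have h5 : lam + 1 ≤ n := (Nat.le_ceil _).trans (by exact_mod_cast h4)
  refine ⟨h3, by positivity, ?_, ?_⟩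
  · rw [div_le_one hn]; linarith
  · rw [mul_div_cancel₀ _ hn.ne']; exact h2.le

/-- Limiting variance. -/
def sig (lam : ℝ) (f : ℕ → ℝ) : ℝ :=
  (Pe lam (fun k => f k * f k) - Pe lam f ^ 2) + lam * Pe lam (fd f) ^ 2

lemma Bn_tendsto {lamn : ℕ → ℝ} {lam : ℝ} (hlam : 0 < lam)
    (hconv : Tendsto lamn atTop (𝓝 lam)) {C A : ℝ} {g : ℕ → ℝ} (hg : Gr C A g) (r : ℕ)
    (hr : r ≤ 2) :
    Tendsto (fun n : ℕ => Bn (lamn n / n) (n - r) g) atTop (𝓝 (Pe lam g)) := by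
  have h1 := Pe_tendsto hlam hconv hg
  have h2 : Tendsto (fun n : ℕ => Bn (lamn n / n) (n - r) g - Pe (lamn n) g) atTop (𝓝 0) := by
    have hb : Tendsto (fun n : ℕ => (∑' k : ℕ, ((k : ℝ) + 1) ^ 2 * ((lam + 1) ^ k / (k.factorial : ℝ)) * (C * A ^ k))
        * ((1 + (lam + 1)) ^ 2 * (n : ℝ)⁻¹)) atTop (𝓝 0) := by
      have := ((tendsto_inv_atTop_nhds_zero_nat (𝕜 := ℝ)).const_mul ((1 + (lam + 1)) ^ 2)).const_mul
        (∑' k : ℕ, ((k : ℝ) + 1) ^ 2 * ((lam + 1) ^ k / (k.factorial : ℝ)) * (C * A ^ k))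
      simpa using this
    refine squeeze_zero_norm' ?_ hb
    filter_upwards [ev_of_tendsto hlam hconv] with n hn
    have hn0 : (n : ℝ) ≠ 0 := by exact_mod_cast (by omega : n ≠ 0)
    have := Bn_sub_Pe (n := n) (m := n - r) (by omega) (by omega) (by omega) hn.2.1 hn.2.2.1 hn.2.2.2 hg
    rw [mul_div_cancel₀ _ hn0] at this
    exact this
  simpa using h2.add h1

lemma centering {lamn : ℕ → ℝ} {lam : ℝ} (hlam : 0 < lam)
    (hconv : Tendsto lamn atTop (𝓝 lam)) {C A : ℝ} {g : ℕ → ℝ} (hg : Gr C A g) :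
    Tendsto (fun n : ℕ => (Real.sqrt n)⁻¹ * (n * Bn (lamn n / n) (n - 1) g - n * Pe (lamn n) g))
      atTop (𝓝 0) := by
  have hb : Tendsto (fun n : ℕ => (∑' k : ℕ, ((k : ℝ) + 1) ^ 2 * ((lam + 1) ^ k / (k.factorial : ℝ)) * (C * A ^ k))
      * (1 + (lam + 1)) ^ 2 * (Real.sqrt n)⁻¹) atTop (𝓝 0) := by
    have : Tendsto (fun n : ℕ => (Real.sqrt n)⁻¹) atTop (𝓝 0) :=
      tendsto_inv_atTop_zero.comp (Real.tendsto_sqrt_atTop.comp tendsto_natCast_atTop_atTop)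
    have := this.const_mul
      ((∑' k : ℕ, ((k : ℝ) + 1) ^ 2 * ((lam + 1) ^ k / (k.factorial : ℝ)) * (C * A ^ k)) * (1 + (lam + 1)) ^ 2)
    simpa using this
  refine squeeze_zero_norm' ?_ hb
  filter_upwards [ev_of_tendsto hlam hconv] with n hn
  have hn0 : (n : ℝ) ≠ 0 := by exact_mod_cast (by omega : n ≠ 0)
  have := Bn_sub_Pe (n := n) (m := n - 1) (by omega) (by omega) (by omega) hn.2.1 hn.2.2.1 hn.2.2.2 hg
  rw [mul_div_cancel₀ _ hn0] at this
  have hs0 : 0 ≤ (Real.sqrt n)⁻¹ := by positivity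
  rw [← mul_sub, norm_mul, norm_mul, Real.norm_of_nonneg hs0, Real.norm_eq_abs, Real.norm_eq_abs,
    Nat.abs_cast]
  calc _ ≤ (Real.sqrt n)⁻¹ * (n * ((∑' k : ℕ, ((k : ℝ) + 1) ^ 2 * ((lam + 1) ^ k / (k.factorial : ℝ)) * (C * A ^ k))
        * ((1 + (lam + 1)) ^ 2 * (n : ℝ)⁻¹))) := by gcongr
    _ = _ := by
      generalize (∑' k : ℕ, ((k : ℝ) + 1) ^ 2 * ((lam + 1) ^ k / (k.factorial : ℝ)) * (C * A ^ k)) = T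
      field_simp

lemma sigN_tendsto {lamn : ℕ → ℝ} {lam : ℝ} (hlam : 0 < lam)
    (hconv : Tendsto lamn atTop (𝓝 lam)) {C A : ℝ} {f : ℕ → ℝ} (hf : Gr C A f) :
    Tendsto (fun n : ℕ => sigN n (lamn n / n) f) atTop (𝓝 (sig lam f)) := by
  have h1 := Bn_tendsto hlam hconv (hf.mul hf) 1 one_le_two
  have h2 := Bn_tendsto hlam hconv hf 1 one_le_two
  have h3 := Bn_tendsto hlam hconv hf.fd 2 le_rfl
  have hi := tendsto_inv_atTop_nhds_zero_nat (𝕜 := ℝ)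
  have h4 : Tendsto (fun n : ℕ => ((n : ℝ) - 1) * (lamn n / n * (1 - lamn n / n))) atTop (𝓝 lam) := by
    have h5 : Tendsto (fun n : ℕ => (1 - (n : ℝ)⁻¹) * lamn n * (1 - lamn n * (n : ℝ)⁻¹)) atTop
        (𝓝 ((1 - 0) * lam * (1 - lam * 0))) :=
      ((hi.const_sub 1).mul hconv).mul ((hconv.mul hi).const_sub 1)
    simp only [sub_zero, one_mul, mul_zero, mul_one] at h5
    refine h5.congr' ?_
    filter_upwards [eventually_ge_atTop 1] with n hn
    have hn0 : (n : ℝ) ≠ 0 := by exact_mod_cast (by omega : n ≠ 0)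
    field_simp
  unfold sig
  refine (((h1.sub (h2.pow 2)).add (h4.mul (h3.pow 2)))).congr fun n => ?_
  unfold sigN
  simp only [pow_two]

lemma sig_nonneg {lamn : ℕ → ℝ} {lam : ℝ} (hlam : 0 < lam)
    (hconv : Tendsto lamn atTop (𝓝 lam)) {C A : ℝ} {f : ℕ → ℝ} (hf : Gr C A f) :
    0 ≤ sig lam f := by
  refine ge_of_tendsto (sigN_tendsto hlam hconv hf) ?_
  filter_upwards [ev_of_tendsto hlam hconv] with n hn
  exact sigN_nonneg hn.1 hn.2.1 hn.2.2.1 f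

/-- Truncation. -/
def trunc (a : ℕ → ℝ) (K : ℕ) (k : ℕ) : ℝ := if k < K then a k else 0

lemma abs_trunc_le (a : ℕ → ℝ) (K k : ℕ) : |trunc a K k| ≤ |a k| := by
  unfold trunc; split_ifs <;> simp

lemma abs_sub_trunc_le (a : ℕ → ℝ) (K k : ℕ) : |a k - trunc a K k| ≤ |a k| := by
  unfold trunc; split_ifs <;> simp

lemma trunc_bdd (a : ℕ → ℝ) (K : ℕ) : ∃ B, ∀ k, |trunc a K k| ≤ B := by
  refine ⟨∑ k ∈ Finset.range K, |a k|, fun k => ?_⟩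
  unfold trunc
  split_ifs with h
  · exact Finset.single_le_sum (f := fun k => |a k|) (fun i _ => abs_nonneg _) (Finset.mem_range.2 h)
  · simp only [abs_zero]
    exact Finset.sum_nonneg fun i _ => abs_nonneg _

lemma Pe_tendsto_seq {lam : ℝ} (hlam : 0 < lam) {C A : ℝ} {g : ℕ → ℕ → ℝ} {g0 : ℕ → ℝ}
    (hg : ∀ K, Gr C A (g K)) (h : ∀ k, Tendsto (fun K => g K k) atTop (𝓝 (g0 k))) :
    Tendsto (fun K => Pe lam (g K)) atTop (𝓝 (Pe lam g0)) := by
  unfold Pe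
  refine tendsto_tsum_of_dominated_convergence (summable_dom lam A C) (fun k => ?_) ?_
  · exact (h k).const_mul _
  · exact Eventually.of_forall fun K k => norm_Pe_term hlam.le le_rfl (hg K) k

lemma sig_tendsto_seq {lam : ℝ} (hlam : 0 < lam) {C A : ℝ} {g : ℕ → ℕ → ℝ} {g0 : ℕ → ℝ}
    (hg : ∀ K, Gr C A (g K)) (h : ∀ k, Tendsto (fun K => g K k) atTop (𝓝 (g0 k))) :
    Tendsto (fun K => sig lam (g K)) atTop (𝓝 (sig lam g0)) := by
  have h1 := Pe_tendsto_seq hlam (fun K => (hg K).mul (hg K)) (g0 := fun k => g0 k * g0 k)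
    (fun k => (h k).mul (h k))
  have h2 := Pe_tendsto_seq hlam hg h
  have h3 := Pe_tendsto_seq hlam (fun K => (hg K).fd) (g0 := fd g0)
    (fun k => (h (k + 1)).sub (h k))
  exact (h1.sub (h2.pow 2)).add ((h3.pow 2).const_mul lam)

lemma trunc_tendsto (a : ℕ → ℝ) (k : ℕ) : Tendsto (fun K => trunc a K k) atTop (𝓝 (a k)) := by
  refine tendsto_const_nhds.congr' ?_
  filter_upwards [eventually_gt_atTop k] with K hK
  simp [trunc, hK]

lemma sig_zero (lam : ℝ) : sig lam (fun _ => 0) = 0 := by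
  simp [sig, Pe, fd]

lemma sig_trunc_tendsto {lam : ℝ} (hlam : 0 < lam) {C A : ℝ} {a : ℕ → ℝ} (ha : Gr C A a) :
    Tendsto (fun K => sig lam (trunc a K)) atTop (𝓝 (sig lam a)) :=
  sig_tendsto_seq hlam (fun K => ha.mono (abs_trunc_le a K)) (trunc_tendsto a)

lemma sig_sub_trunc_tendsto {lam : ℝ} (hlam : 0 < lam) {C A : ℝ} {a : ℕ → ℝ} (ha : Gr C A a) :
    Tendsto (fun K => sig lam (fun k => a k - trunc a K k)) atTop (𝓝 0) := by
  rw [← sig_zero lam]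
  refine sig_tendsto_seq hlam (fun K => ha.mono (abs_sub_trunc_le a K)) fun k => ?_
  simpa using (trunc_tendsto a k).const_sub (a k)

lemma Pe_fd {lam : ℝ} (hlam : 0 < lam) {C A : ℝ} {f : ℕ → ℝ} (hf : Gr C A f) :
    lam * Pe lam (fd f) = Pe lam (fun k => ((k : ℝ) - lam) * f k) := by
  have s0 := summable_Pe hlam.le hf
  have s1 := summable_Pe hlam.le hf.shift
  have s2 := summable_Pe hlam.le (Gr_id.mul hf)
  have e1 : Pe lam (fd f) = ∑' k, poissonProb lam k * f (k + 1) - ∑' k, poissonProb lam k * f k := by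
    rw [← s1.tsum_sub s0]
    exact tsum_congr fun k => by unfold fd; ring
  have e2 : Pe lam (fun k => ((k : ℝ) - lam) * f k)
      = ∑' k : ℕ, poissonProb lam k * ((k : ℝ) * f k) - lam * ∑' k, poissonProb lam k * f k := by
    rw [← tsum_mul_left, ← s2.tsum_sub (s0.mul_left lam)]
    exact tsum_congr fun k => by ring
  have e3 : ∑' k : ℕ, poissonProb lam k * ((k : ℝ) * f k)
      = lam * ∑' k, poissonProb lam k * f (k + 1) := by
    rw [s2.tsum_eq_zero_add, ← tsum_mul_left]
    simp only [Nat.cast_zero, zero_mul, mul_zero, zero_add]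
    refine tsum_congr fun k => ?_
    unfold poissonProb
    rw [Nat.factorial_succ]
    have : (k.factorial : ℝ) ≠ 0 := by exact_mod_cast k.factorial_ne_zero
    push_cast
    field_simp
    ring
  rw [e1, e2, e3]
  ring

lemma sig_eq {lam : ℝ} (hlam : 0 < lam) {C A : ℝ} {a : ℕ → ℝ} (ha : Gr C A a) :
    (∑' j : ℕ, ∑' k : ℕ, a j * a k *
            (poissonProb lam j * poissonProb lam k *
                (((j : ℝ) - lam) * ((k : ℝ) - lam) / lam - 1) +
              poissonProb lam k * (if j = k then 1 else 0))) = sig lam a := by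
  set P := Pe lam a with hP
  set Q := Pe lam (fun k => ((k : ℝ) - lam) * a k) with hQ
  have s0 := summable_Pe hlam.le ha
  have s1 := summable_Pe hlam.le (Gr_id.mul ha)
  have s2 : Summable fun k : ℕ => poissonProb lam k * (((k : ℝ) - lam) * a k) :=
    (s1.sub (s0.mul_left lam)).congr fun k => by ring
  have s3 := summable_Pe hlam.le (ha.mul ha)
  have inner : ∀ j : ℕ, (∑' k : ℕ, a j * a k *
            (poissonProb lam j * poissonProb lam k *
                (((j : ℝ) - lam) * ((k : ℝ) - lam) / lam - 1) +
              poissonProb lam k * (if j = k then 1 else 0)))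
      = (poissonProb lam j * (((j : ℝ) - lam) * a j)) * (Q / lam)
        - (poissonProb lam j * a j) * P + poissonProb lam j * (a j * a j) := by
    intro j
    have s4 : HasSum (fun k : ℕ => a j * a k * (poissonProb lam k * (if j = k then 1 else 0)))
        (poissonProb lam j * (a j * a j)) := by
      have := hasSum_single (f := fun k : ℕ => a j * a k * (poissonProb lam k * (if j = k then 1 else 0))) j
        (fun k hk => by simp [hk.symm])
      simp only [if_true] at this
      convert this using 1
      ring
    have s5 := s2.hasSum.mul_left (poissonProb lam j * (((j : ℝ) - lam) * a j) / lam)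
    have s6 := s0.hasSum.mul_left (poissonProb lam j * a j)
    have := ((s5.sub s6).add s4).tsum_eq
    refine Eq.trans (tsum_congr fun k => ?_) (this.trans ?_)
    · ring
    · rw [hP, hQ]
      unfold Pe
      ring
  rw [tsum_congr inner]
  have h := (((s2.hasSum.mul_right (Q / lam)).sub (s0.hasSum.mul_right P)).add s3.hasSum).tsum_eq
  rw [h]
  have hfd := Pe_fd hlam ha
  rw [← hQ] at hfd
  unfold sig
  rw [← hP]
  change Q * (Q / lam) - P * P + Pe lam _ = _
  rw [← hfd]
  field_simp
  ring

end LimitVar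

/-! ### Assembly -/

section Assembly

lemma Xn_sub {n : ℕ} (p : ℝ) (f g : ℕ → ℝ) (S : EdgeIdx n → Bool) :
    Xn n p f S - Xn n p g S = Xn n p (fun k => f k - g k) S := by
  unfold Xn
  rw [Bn_sub, Finset.sum_sub_distrib]
  ring

lemma char_diff {n : ℕ} (hn : 3 ≤ n) {p : ℝ} (h0 : 0 ≤ p) (h1 : p ≤ 1) (f g : ℕ → ℝ) (τ : ℝ) :
    ‖Ex p (fun S => eit (τ * Xn n p f S)) - Ex p (fun S => eit (τ * Xn n p g S))‖
      ≤ |τ| * Real.sqrt (sigN n p (fun k => f k - g k)) := by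
  rw [← Ex_sub]
  refine (norm_Ex_le h0 h1 _).trans ?_
  have h : Ex p (fun S => ‖eit (τ * Xn n p f S) - eit (τ * Xn n p g S)‖)
      ≤ Ex p (fun S => |τ| * |Xn n p (fun k => f k - g k) S|) := by
    refine Ex_mono h0 h1 fun S => (norm_eit_sub _ _).trans ?_
    rw [← mul_sub, Xn_sub, abs_mul]
  refine h.trans ?_
  rw [Ex_mul_left]
  gcongr
  apply Real.le_sqrt_of_sq_le
  refine (Ex_sq_le h0 h1 _).trans (le_of_eq ?_)
  rw [← Ex_Xn_sq hn]
  simp only [sq_abs]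

lemma exchange {F : ℕ → ℂ} {FK : ℕ → ℕ → ℂ} {G : ℕ → ℂ} {g : ℂ} {e : ℕ → ℕ → ℝ} {e' : ℕ → ℝ}
    (hF : ∀ K, Tendsto (FK K) atTop (𝓝 (G K))) (hG : Tendsto G atTop (𝓝 g))
    (hle : ∀ K, ∀ᶠ n in atTop, ‖F n - FK K n‖ ≤ e K n)
    (he : ∀ K, Tendsto (e K) atTop (𝓝 (e' K))) (he' : Tendsto e' atTop (𝓝 0)) :
    Tendsto F atTop (𝓝 g) := by
  rw [Metric.tendsto_nhds]
  intro ε hε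
  have h1 := Metric.tendsto_nhds.1 hG (ε / 3) (by positivity)
  have h2 := he'.eventually (gt_mem_nhds (by positivity : (0 : ℝ) < ε / 3))
  obtain ⟨K, hK1, hK2⟩ := (h1.and h2).exists
  filter_upwards [hle K, (he K).eventually (gt_mem_nhds hK2),
    Metric.tendsto_nhds.1 (hF K) (ε / 3) (by positivity)] with n a b c
  have t1 := dist_triangle (F n) (FK K n) g
  have t2 := dist_triangle (FK K n) (G K) g
  rw [dist_eq_norm (F n) (FK K n)] at t1
  linarith

lemma char_tendsto {lamn : ℕ → ℝ} {lam : ℝ} (hlam : 0 < lam)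
    (hconv : Tendsto lamn atTop (𝓝 lam)) {C A : ℝ} {a : ℕ → ℝ} (ha : Gr C A a) (τ : ℝ) :
    Tendsto (fun n : ℕ => Ex (lamn n / n) (fun S => eit (τ * Xn n (lamn n / n) a S))) atTop
      (𝓝 ((Real.exp (-(sig lam a * τ ^ 2 / 2)) : ℝ) : ℂ)) := by
  have hev := ev_of_tendsto hlam hconv
  refine exchange
    (FK := fun K n => Ex (lamn n / n) (fun S => eit (τ * Xn n (lamn n / n) (trunc a K) S)))
    (G := fun K => ((Real.exp (-(sig lam (trunc a K) * τ ^ 2 / 2)) : ℝ) : ℂ))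
    (e := fun K n => |τ| * Real.sqrt (sigN n (lamn n / n) (fun k => a k - trunc a K k)))
    (e' := fun K => |τ| * Real.sqrt (sig lam (fun k => a k - trunc a K k))) ?_ ?_ ?_ ?_ ?_
  · intro K
    obtain ⟨B, hB⟩ := trunc_bdd a K
    exact char_tendsto_bdd hev hB (sigN_tendsto hlam hconv (ha.mono (abs_trunc_le a K))) τ
  · refine (Complex.continuous_ofReal.tendsto _).comp ((Real.continuous_exp.tendsto _).comp ?_)
    exact (((sig_trunc_tendsto hlam ha).mul_const _).div_const _).neg
  · intro K
    filter_upwards [hev] with n hn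
    exact char_diff hn.1 hn.2.1 hn.2.2.1 _ _ τ
  · intro K
    exact ((Real.continuous_sqrt.tendsto _).comp
      (sigN_tendsto hlam hconv (ha.mono (abs_sub_trunc_le a K)))).const_mul _
  · have := ((Real.continuous_sqrt.tendsto _).comp (sig_sub_trunc_tendsto hlam ha)).const_mul |τ|
    simpa using this

/-- The normalized statistic of the theorem. -/
def Yn (n : ℕ) (mu : ℝ) (a : ℕ → ℝ) (S : EdgeIdx n → Bool) : ℝ :=
  (Real.sqrt n)⁻¹ * ((∑' k : ℕ, a k * (degCount n k S : ℝ)) - n * ∑' k : ℕ, a k * poissonProb mu k)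

lemma tsum_degCount (n : ℕ) (a : ℕ → ℝ) (S : EdgeIdx n → Bool) :
    (∑' k : ℕ, a k * (degCount n k S : ℝ)) = ∑ v, a (cnt (inc n v) S) := by
  have h : ∀ k, a k * (degCount n k S : ℝ) = ∑ v : Fin n, if degree n S v = k then a k else 0 := by
    intro k
    unfold degCount
    rw [← Finset.sum_filter, Finset.sum_const, nsmul_eq_mul, mul_comm]
  have hs : ∀ v : Fin n, HasSum (fun k => if degree n S v = k then a k else 0) (a (degree n S v)) := by
    intro v
    have := hasSum_single (f := fun k => if degree n S v = k then a k else 0) (degree n S v)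
      (fun k hk => by simp [hk.symm])
    simpa using this
  rw [tsum_congr h, (hasSum_sum fun v _ => hs v).tsum_eq]
  simp only [degree_eq_cnt]

lemma Yn_eq (n : ℕ) (p mu : ℝ) (a : ℕ → ℝ) (S : EdgeIdx n → Bool) :
    Yn n mu a S = Xn n p a S + (Real.sqrt n)⁻¹ * (n * Bn p (n - 1) a - n * Pe mu a) := by
  unfold Yn Xn Pe
  rw [tsum_degCount]
  simp only [mul_comm (a _)]
  ring

lemma char_Yn {lamn : ℕ → ℝ} {lam : ℝ} (hlam : 0 < lam)
    (hconv : Tendsto lamn atTop (𝓝 lam)) {C A : ℝ} {a : ℕ → ℝ} (ha : Gr C A a) (τ : ℝ) :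
    Tendsto (fun n : ℕ => Ex (lamn n / n) (fun S => eit (τ * Yn n (lamn n) a S))) atTop
      (𝓝 ((Real.exp (-(sig lam a * τ ^ 2 / 2)) : ℝ) : ℂ)) := by
  have h1 := char_tendsto hlam hconv ha τ
  have h2 : Tendsto (fun n : ℕ => eit (τ * ((Real.sqrt n)⁻¹ *
      (n * Bn (lamn n / n) (n - 1) a - n * Pe (lamn n) a)))) atTop (𝓝 1) := by
    have hc : Continuous eit := by unfold eit; fun_prop
    have := (hc.tendsto _).comp ((centering hlam hconv ha).const_mul τ)
    have e0 : eit (τ * 0) = 1 := by simp [eit]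
    rw [e0] at this
    exact this
  have h3 := h1.mul h2
  rw [mul_one] at h3
  refine h3.congr fun n => ?_
  rw [← Ex_mul_right]
  congr 1
  funext S
  rw [← eit_add, ← mul_add, ← Yn_eq]

lemma ofReal_wt {n : ℕ} {p : ℝ} (h0 : 0 ≤ p) (h1 : p ≤ 1) (S : EdgeIdx n → Bool) :
    (∏ e : EdgeIdx n, if S e then ENNReal.ofReal p else ENNReal.ofReal (1 - p))
      = ENNReal.ofReal (wt p S) := by
  unfold wt
  rw [ENNReal.ofReal_prod_of_nonneg]
  · refine Finset.prod_congr rfl fun e _ => ?_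
    split_ifs <;> rfl
  · intro e _
    split_ifs <;> linarith

lemma gnp_eq {n : ℕ} {p : ℝ} (h0 : 0 ≤ p) (h1 : p ≤ 1) :
    gnpMeasure n p = ∑ S : EdgeIdx n → Bool, ENNReal.ofReal (wt p S) • Measure.dirac S := by
  unfold gnpMeasure
  exact Finset.sum_congr rfl fun S _ => by rw [ofReal_wt h0 h1]

lemma gnp_prob {n : ℕ} {p : ℝ} (h0 : 0 ≤ p) (h1 : p ≤ 1) :
    IsProbabilityMeasure (gnpMeasure n p) := by
  constructor
  rw [gnp_eq h0 h1, Measure.finsetSum_apply]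
  simp only [Measure.smul_apply, smul_eq_mul, measure_univ, mul_one]
  rw [← ENNReal.ofReal_sum_of_nonneg (fun S _ => wt_nonneg h0 h1 S), sum_wt, ENNReal.ofReal_one]

lemma integral_gnp {n : ℕ} {p : ℝ} (h0 : 0 ≤ p) (h1 : p ≤ 1) (g : (EdgeIdx n → Bool) → ℂ) :
    ∫ S, g S ∂(gnpMeasure n p) = Ex p g := by
  have hm : Measurable g := measurable_of_countable g
  rw [gnp_eq h0 h1, integral_finsetSum_measure]
  · unfold Ex
    refine Finset.sum_congr rfl fun S _ => ?_
    rw [integral_smul_measure, integral_dirac, ENNReal.toReal_ofReal (wt_nonneg h0 h1 S)]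
  · intro S _
    exact (integrable_dirac (by finiteness)).smul_measure ENNReal.ofReal_ne_top

lemma charFun_gnp {n : ℕ} {p : ℝ} (h0 : 0 ≤ p) (h1 : p ≤ 1) (Y : (EdgeIdx n → Bool) → ℝ) (t : ℝ) :
    charFun ((gnpMeasure n p).map Y) t = Ex p (fun S => eit (t * Y S)) := by
  have hm : Measurable Y := measurable_of_countable Y
  rw [charFun_apply_real, integral_map hm.aemeasurable (by fun_prop), integral_gnp h0 h1]
  congr 1
  funext S
  unfold eit
  push_cast
  ring_nf

open Classical in
/-- The law of `Yn`, replaced by a point mass for irrelevant parameters. -/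
def lawM (a : ℕ → ℝ) (n : ℕ) (mu : ℝ) : Measure ℝ :=
  if 0 ≤ mu / n ∧ mu / n ≤ 1 then (gnpMeasure n (mu / n)).map (Yn n mu a) else Measure.dirac 0

lemma lawM_prob (a : ℕ → ℝ) (n : ℕ) (mu : ℝ) : IsProbabilityMeasure (lawM a n mu) := by
  unfold lawM
  split_ifs with h
  · have := gnp_prob (n := n) h.1 h.2
    exact Measure.isProbabilityMeasure_map (measurable_of_countable _).aemeasurable
  · infer_instance

/-- The law of `Yn`, as a probability measure. -/
def lawY (a : ℕ → ℝ) (n : ℕ) (mu : ℝ) : ProbabilityMeasure ℝ := ⟨lawM a n mu, lawM_prob a n mu⟩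

lemma lawY_coe {a : ℕ → ℝ} {n : ℕ} {mu : ℝ} (h0 : 0 ≤ mu / n) (h1 : mu / n ≤ 1) :
    (lawY a n mu : Measure ℝ) = (gnpMeasure n (mu / n)).map (Yn n mu a) := by
  change lawM a n mu = _
  unfold lawM
  rw [if_pos ⟨h0, h1⟩]

lemma exists_Gr {a : ℕ → ℝ} {A : ℝ} (hA : ∃ C : ℝ, ∀ k, |a k| ≤ C * A ^ k) :
    ∃ C A' : ℝ, Gr C A' a := by
  obtain ⟨C, hC⟩ := hA
  refine ⟨|C|, |A| + 1, abs_nonneg _, by linarith [abs_nonneg A], fun k => (hC k).trans ?_⟩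
  calc C * A ^ k ≤ |C * A ^ k| := le_abs_self _
    _ = |C| * |A| ^ k := by rw [abs_mul, abs_pow]
    _ ≤ _ := by
      gcongr
      linarith

end Assembly

/-- Theorem 4.1(i), linear-combination form (display (4.2)): asymptotic normality of
`Σ_k a_k N_k` in `G(n, λₙ/n)` for coefficients `a_k = O(A^k)`. -/
theorem gnp_degree_counts_linear_combination_clt
    (lamn : ℕ → ℝ) (lam : ℝ) (hlam : 0 < lam)
    (hconv : Tendsto lamn atTop (𝓝 lam))
    (a : ℕ → ℝ) (A : ℝ) (hA : ∃ C : ℝ, ∀ k, |a k| ≤ C * A ^ k) :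
    TendstoInDistribution
      (fun n => (gnpMeasure n (lamn n / n)).map
        (fun S => (Real.sqrt n)⁻¹ *
          ((∑' k : ℕ, a k * (degCount n k S : ℝ)) -
            n * ∑' k : ℕ, a k * poissonProb (lamn n) k)))
      (gaussianReal 0
        (Real.toNNReal
          (∑' j : ℕ, ∑' k : ℕ, a j * a k *
            (poissonProb lam j * poissonProb lam k *
                (((j : ℝ) - lam) * ((k : ℝ) - lam) / lam - 1) +
              poissonProb lam k * (if j = k then 1 else 0))))) := by
  obtain ⟨C, A', ha⟩ := exists_Gr hA
  have hev := ev_of_tendsto hlam hconv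
  rw [sig_eq hlam ha]
  have hs := sig_nonneg hlam hconv ha
  intro f
  have key : Tendsto (fun n => lawY a n (lamn n)) atTop
      (𝓝 (⟨gaussianReal 0 (Real.toNNReal (sig lam a)), inferInstance⟩ : ProbabilityMeasure ℝ)) := by
    refine ProbabilityMeasure.tendsto_of_tendsto_charFun fun t => ?_
    have h1 := char_Yn hlam hconv ha t
    have e : charFun (gaussianReal 0 (Real.toNNReal (sig lam a))) t
        = ((Real.exp (-(sig lam a * t ^ 2 / 2)) : ℝ) : ℂ) := by
      rw [charFun_gaussianReal, Real.coe_toNNReal _ hs]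
      push_cast
      congr 1
      ring
    change Tendsto _ _ (𝓝 (charFun (gaussianReal 0 (Real.toNNReal (sig lam a))) t))
    rw [e]
    refine h1.congr' ?_
    filter_upwards [hev] with n hn
    rw [lawY_coe hn.2.1 hn.2.2.1, charFun_gnp hn.2.1 hn.2.2.1]
  have h2 := (ProbabilityMeasure.tendsto_iff_forall_integral_tendsto.1 key) f
  refine Tendsto.congr' ?_ h2
  filter_upwards [hev] with n hn
  rw [lawY_coe hn.2.1 hn.2.2.1]
  rfl
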